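/- Let Ω ⊆ ℝⁿ be an open set and let u be a convex function on Ω whose Monge–Ampère measure satisfies λ·|E| ≤ Mu(E) ≤ Λ·|E| for every Borel set E ⊆ Ω, where 0 < λ ≤ Λ are constants. Then for every non-degenerate line segment L ⊆ Σ_u and every point x₀ in the relative interior of L, there exist r > 0 with B_r(x₀) ⊆ Ω and a convex function v on B_r(x₀) such that v ≤ u on B_r(x₀), v(x₀) = u(x₀), v is not identically equal to u on B_r(x₀), and Mv(E) = Mu(E) for every Borel set E ⊆ B_r(x₀) (where Mv is computed with respect to the domain B_r(x₀)). -/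

import Mathlib

open MeasureTheory Set
open scoped RealInnerProductSpace ENNReal

noncomputable section

abbrev En (n : ℕ) := EuclideanSpace ℝ (Fin n)

/-- The subgradient of `u` (as a convex function on `Ω`) at `x`. -/
def subgrad {n : ℕ} (Ω : Set (En n)) (u : En n → ℝ) (x : En n) : Set (En n) :=
  {p | ∀ y ∈ Ω, u x + ⟪p, y - x⟫ ≤ u y}

/-- The Monge–Ampère measure of `u` on a set `s`: the Lebesgue measure of the image of `s`
under the subgradient map. -/
def MAm {n : ℕ} (Ω : Set (En n)) (u : En n → ℝ) (s : Set (En n)) : ℝ≥0∞ :=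
  volume (⋃ x ∈ s, subgrad Ω u x)

/-- `x₀` is a strictly convex point of `u` on `Ω`. -/
def IsStrictConvexPt {n : ℕ} (Ω : Set (En n)) (u : En n → ℝ) (x₀ : En n) : Prop :=
  ∀ x ∈ Ω, x ≠ x₀ → u ((1/2 : ℝ) • (x + x₀)) < (u x + u x₀) / 2

/-- `Σ_u`: the set of non-strictly convex points of `u` in `Ω`. -/
def SigmaSet {n : ℕ} (Ω : Set (En n)) (u : En n → ℝ) : Set (En n) :=
  {x ∈ Ω | ¬ IsStrictConvexPt Ω u x}

section Subgradients

variable {n : ℕ}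

lemma subgrad_nonempty {Ω : Set (En n)} (hΩ : IsOpen Ω) {u : En n → ℝ} (hu : ConvexOn ℝ Ω u)
    {x : En n} (hx : x ∈ Ω) : (subgrad Ω u x).Nonempty := by
  have hcont : ContinuousOn u Ω := hu.continuousOn hΩ
  have hconv : Convex ℝ {q : En n × ℝ | q.1 ∈ Ω ∧ u q.1 < q.2} := hu.convex_strict_epigraph
  have hopen : IsOpen {q : En n × ℝ | q.1 ∈ Ω ∧ u q.1 < q.2} := by
    have h1 : ContinuousOn (fun q : En n × ℝ => q.2 - u q.1) (Ω ×ˢ univ) :=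
      continuousOn_snd.sub (hcont.comp continuousOn_fst fun q hq => hq.1)
    have h2 := h1.isOpen_inter_preimage (hΩ.prod isOpen_univ) (isOpen_Ioi (a := (0 : ℝ)))
    convert h2 using 1
    ext q
    simp
  obtain ⟨f, hf⟩ := geometric_hahn_banach_point_open hconv hopen
    (x := (x, u x)) (by simp)
  have hsplit : ∀ y t, f (y, t) = f (y, 0) + t * f (0, 1) := by
    intro y t
    have : ((y, t) : En n × ℝ) = (y, 0) + t • (0, 1) := by simp
    rw [this, map_add, map_smul, smul_eq_mul]
  have hc : 0 < f (0, 1) := by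
    have := hf (x, u x + 1) ⟨hx, by simp⟩
    rw [hsplit x (u x), hsplit x (u x + 1)] at this
    linarith
  set g : StrongDual ℝ (En n) := f.comp (ContinuousLinearMap.inl ℝ (En n) ℝ) with hg
  refine ⟨(InnerProductSpace.toDual ℝ (En n)).symm (-(f (0, 1))⁻¹ • g), fun y hy => ?_⟩
  rw [InnerProductSpace.toDual_symm_apply]
  have hle : ∀ ε > 0, f (x, u x) ≤ f (y, u y) + ε * f (0, 1) := by
    intro ε hε
    have := hf (y, u y + ε) ⟨hy, by simpa using hε⟩
    rw [hsplit y (u y + ε)] at this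
    rw [hsplit y (u y)]
    linarith
  have hle' : f (x, u x) ≤ f (y, u y) := by
    by_contra! hlt
    have h3 := hle ((f (x, u x) - f (y, u y)) / (2 * f (0, 1)))
      (div_pos (by linarith) (by linarith))
    have h4 : (f (x, u x) - f (y, u y)) / (2 * f (0, 1)) * f (0, 1)
      = (f (x, u x) - f (y, u y)) / 2 := by field_simp
    rw [h4] at h3
    linarith
  rw [hsplit x, hsplit y] at hle'
  have hgy : g (y - x) = f (y, 0) - f (x, 0) := by
    rw [map_sub]; simp [hg]
  simp only [_root_.smul_apply, smul_eq_mul, hgy]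
  have : (f (0, 1))⁻¹ * (f (x, 0) + u x * f (0, 1)) ≤ (f (0, 1))⁻¹ * (f (y, 0) + u y * f (0, 1)) :=
    mul_le_mul_of_nonneg_left hle' (inv_pos.2 hc).le
  have e1 : (f (0, 1))⁻¹ * (f (x, 0) + u x * f (0, 1)) = (f (0, 1))⁻¹ * f (x, 0) + u x := by
    field_simp
  have e2 : (f (0, 1))⁻¹ * (f (y, 0) + u y * f (0, 1)) = (f (0, 1))⁻¹ * f (y, 0) + u y := by
    field_simp
  rw [e1, e2] at this
  linarith

lemma convexOn_sub_inner {Ω : Set (En n)} {u : En n → ℝ} (hu : ConvexOn ℝ Ω u) (p : En n) (c : ℝ) :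
    ConvexOn ℝ Ω (fun y => u y - (⟪p, y⟫ + c)) := by
  refine ⟨hu.1, fun x hx y hy a b ha hb hab => ?_⟩
  have := hu.2 hx hy ha hb hab
  simp only [smul_eq_mul, inner_add_right, inner_smul_right] at this ⊢
  have hc : c = a * c + b * c := by rw [← add_mul, hab, one_mul]
  nlinarith

lemma mem_subgrad_of_isLocalMin {Ω : Set (En n)} {u : En n → ℝ}
    (hu : ConvexOn ℝ Ω u) {x p : En n} (hx : x ∈ Ω)
    (hmin : IsLocalMin (fun y => u y - ⟪p, y⟫) x) : p ∈ subgrad Ω u x := by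
  have hconv := convexOn_sub_inner hu p 0
  simp only [add_zero] at hconv
  have := IsMinOn.of_isLocalMinOn_of_convexOn hx (hmin.on Ω) hconv
  intro y hy
  have h := this hy
  simp only [mem_ofPred_eq] at h
  rw [inner_sub_right]
  linarith

lemma subgrad_anti {Ω Ω' : Set (En n)} (h : Ω' ⊆ Ω) (u : En n → ℝ) (x : En n) :
    subgrad Ω u x ⊆ subgrad Ω' u x := fun _ hp y hy => hp y (h hy)

lemma subgrad_eq_of_isOpen {Ω B : Set (En n)} (hB : IsOpen B) (hBΩ : B ⊆ Ω)
    {u : En n → ℝ} (hu : ConvexOn ℝ Ω u) {x : En n} (hx : x ∈ B) :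
    subgrad B u x = subgrad Ω u x := by
  refine Subset.antisymm (fun p hp => ?_) (subgrad_anti hBΩ u x)
  refine mem_subgrad_of_isLocalMin hu (hBΩ hx) ?_
  filter_upwards [hB.mem_nhds hx] with y hy
  have := hp y hy
  rw [inner_sub_right] at this
  linarith

lemma MAm_eq_of_isOpen {Ω B : Set (En n)} (hB : IsOpen B) (hBΩ : B ⊆ Ω)
    {u : En n → ℝ} (hu : ConvexOn ℝ Ω u) {s : Set (En n)} (hs : s ⊆ B) :
    MAm B u s = MAm Ω u s := by
  unfold MAm
  congr 1
  exact iUnion₂_congr fun x hx => subgrad_eq_of_isOpen hB hBΩ hu (hs hx)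

lemma subgrad_add_inner (Ω : Set (En n)) (u : En n → ℝ) (q : En n) (c : ℝ) (x : En n) :
    subgrad Ω (fun y => u y + (⟪q, y⟫ + c)) x = (fun p => q + p) '' subgrad Ω u x := by
  ext p
  simp only [subgrad, mem_ofPred_eq, mem_image]
  constructor
  · intro h
    refine ⟨p - q, fun y hy => ?_, by abel⟩
    have := h y hy
    rw [inner_sub_left, inner_sub_right q]
    linarith
  · rintro ⟨p', h, rfl⟩ y hy
    have := h y hy
    rw [inner_add_left, inner_sub_right q]
    linarith

lemma MAm_add_inner (Ω : Set (En n)) (u : En n → ℝ) (q : En n) (c : ℝ) (s : Set (En n)) :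
    MAm Ω (fun y => u y + (⟪q, y⟫ + c)) s = MAm Ω u s := by
  unfold MAm
  simp_rw [subgrad_add_inner, ← image_iUnion, image_add_left, measure_preimage_add]

lemma MAm_sub_inner (Ω : Set (En n)) (u : En n → ℝ) (q : En n) (c : ℝ) (s : Set (En n)) :
    MAm Ω (fun y => u y - (⟪q, y⟫ + c)) s = MAm Ω u s := by
  rw [← MAm_add_inner Ω u (-q) (-c) s]
  congr 1
  ext y
  rw [inner_neg_left]
  ring

end Subgradients

section ExtremePoints

lemma isCompact_convexJoin {E : Type*} [NormedAddCommGroup E] [NormedSpace ℝ E] {s t : Set E}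
    (hs : IsCompact s) (ht : IsCompact t) : IsCompact (convexJoin ℝ s t) := by
  have h := (isCompact_Icc (a := (0 : ℝ)) (b := 1)).prod (hs.prod ht)
  have h2 := h.image (f := fun q : ℝ × E × E => AffineMap.lineMap q.2.1 q.2.2 q.1)
    (by simp only [AffineMap.lineMap_apply]; fun_prop)
  convert h2 using 1
  ext x
  simp only [mem_convexJoin, segment_eq_image_lineMap, mem_image, Prod.exists, mem_prod]
  constructor
  · rintro ⟨a, ha, b, hb, θ, hθ, rfl⟩
    exact ⟨θ, a, b, ⟨hθ, ha, hb⟩, rfl⟩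
  · rintro ⟨θ, a, b, ⟨hθ, ha, hb⟩, rfl⟩
    exact ⟨a, ha, b, hb, θ, hθ, rfl⟩

/-- A compact set missing an extreme point `x₀` of a compact convex set `Z` lies in a compact
convex set missing `x₀`. -/
lemma exists_isCompact_convex_of_mem_extremePoints {E : Type*} [NormedAddCommGroup E]
    [NormedSpace ℝ E] {Z C : Set E} {x₀ : E} (hZ : Convex ℝ Z) (hZc : IsCompact Z)
    (hx₀ : x₀ ∈ Z.extremePoints ℝ) (hC : IsCompact C) (hCZ : C ⊆ Z \ {x₀}) :
    ∃ D, IsCompact D ∧ Convex ℝ D ∧ C ⊆ D ∧ D ⊆ Z \ {x₀} := by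
  have hV : Convex ℝ (Z \ {x₀}) := (hZ.mem_extremePoints_iff_convex_sdiff.1 hx₀).2
  refine hC.induction_on (p := fun s => ∃ D, IsCompact D ∧ Convex ℝ D ∧ s ⊆ D ∧ D ⊆ Z \ {x₀})
    ⟨∅, isCompact_empty, convex_empty, Subset.rfl, empty_subset _⟩ ?_ ?_ ?_
  · rintro s t hst ⟨D, h1, h2, h3, h4⟩
    exact ⟨D, h1, h2, hst.trans h3, h4⟩
  · rintro s t ⟨D, h1, h2, h3, h4⟩ ⟨D', h1', h2', h3', h4'⟩
    rcases D.eq_empty_or_nonempty with rfl | hD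
    · exact ⟨D', h1', h2', union_subset (h3.trans (empty_subset _)) h3', h4'⟩
    rcases D'.eq_empty_or_nonempty with rfl | hD'
    · exact ⟨D, h1, h2, union_subset h3 (h3'.trans (empty_subset _)), h4⟩
    exact ⟨convexJoin ℝ D D', isCompact_convexJoin h1 h1', h2.convexJoin h2',
      union_subset (h3.trans (subset_convexJoin_left hD')) (h3'.trans (subset_convexJoin_right hD)),
      convexJoin_subset h4 h4' hV⟩
  · intro x hx
    have hne : 0 < dist x x₀ := dist_pos.2 (hCZ hx).2
    refine ⟨Metric.closedBall x (dist x x₀ / 2) ∩ C,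
      Filter.inter_mem (mem_nhdsWithin_of_mem_nhds (Metric.closedBall_mem_nhds x (by positivity)))
        self_mem_nhdsWithin,
      Metric.closedBall x (dist x x₀ / 2) ∩ Z, hZc.inter_left Metric.isClosed_closedBall,
      (convex_closedBall _ _).inter hZ, inter_subset_inter_right _ fun y hy => (hCZ hy).1, ?_⟩
    rintro y ⟨hy, hyZ⟩
    refine ⟨hyZ, ?_⟩
    rintro rfl
    rw [Metric.mem_closedBall, dist_comm] at hy
    linarith

end ExtremePoints

section Sections

variable {n : ℕ}

lemma volume_le_of_contact {Ω : Set (En n)} {U : En n → ℝ} (hU : ConvexOn ℝ Ω U)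
    (hΩ : IsOpen Ω) {T : Set (En n)} (hTΩ : T ⊆ Ω) (hT : IsCompact T)
    (hTn : ∀ x ∈ T, U x < 0 → T ∈ nhds x) {z : En n} (hz : z ∈ T) :
    volume {p : En n | ∀ y ∈ T, ⟪p, y - z⟫ < - U z} ≤ MAm Ω U T := by
  refine measure_mono fun p hp => ?_
  have hc : ContinuousOn (fun y => U y - ⟪p, y⟫) T :=
    ((hU.continuousOn hΩ).mono hTΩ).sub (by fun_prop)
  obtain ⟨x, hxT, hx⟩ := hT.exists_isMinOn ⟨z, hz⟩ hc
  have hxz := hx hz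
  have hpx := hp x hxT
  simp only [mem_ofPred_eq] at hxz
  rw [inner_sub_right] at hpx
  have hneg : U x < 0 := by linarith
  exact mem_biUnion hxT (mem_subgrad_of_isLocalMin hU (hTΩ hxT) (hx.isLocalMin (hTn x hxT hneg)))

lemma le_volume_of_lower_bound {Ω : Set (En n)} {U : En n → ℝ} {lam : ℝ}
    (hMA : ∀ s : Set (En n), s ⊆ Ω → MeasurableSet s → ENNReal.ofReal lam * volume s ≤ MAm Ω U s)
    {T : Set (En n)} (hTΩ : T ⊆ Ω) (hT : IsCompact T) (hTc : Convex ℝ T) {m : ℝ}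
    (hT0 : ∀ x ∈ T, U x ≤ 0) (hTm : ∀ x ∈ T, -m ≤ U x) {c : En n} (hc : c ∈ T) :
    ENNReal.ofReal lam * (ENNReal.ofReal ((1 / 2) ^ n) * volume T) ≤
      volume {q : En n | ∀ y ∈ T, ⟪q, y - c⟫ ≤ 2 * m} := by
  set T' : Set (En n) := AffineMap.homothety c (1 / 2 : ℝ) '' T with hT'
  have hvol : volume T' = ENNReal.ofReal ((1 / 2) ^ n) * volume T := by
    rw [hT', Measure.addHaar_image_homothety]
    simp
  have hcomp : IsCompact T' := hT.image (AffineMap.homothety_continuous c _)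
  have hsub : T' ⊆ T := by
    rintro _ ⟨y, hy, rfl⟩
    rw [AffineMap.homothety_eq_lineMap]
    exact hTc.lineMap_mem hc hy ⟨by norm_num, by norm_num⟩
  rw [← hvol]
  refine (hMA T' (hsub.trans hTΩ) hcomp.measurableSet).trans (measure_mono ?_)
  intro q hq
  simp only [mem_iUnion, exists_prop] at hq
  obtain ⟨x, ⟨y', hy', rfl⟩, hq⟩ := hq
  intro y hy
  set x := AffineMap.homothety c (1 / 2 : ℝ) y' with hx
  have hxe : x = (1 / 2 : ℝ) • (y' - c) + c := by simp [hx, AffineMap.homothety_apply]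
  have hmem : (1 / 2 : ℝ) • y' + (1 / 2 : ℝ) • y ∈ T :=
    hTc hy' hy (by norm_num) (by norm_num) (by norm_num)
  have h1 := hq _ (hTΩ hmem)
  have h2 : (1 / 2 : ℝ) • y' + (1 / 2 : ℝ) • y - x = (1 / 2 : ℝ) • (y - c) := by
    rw [hxe]
    have : c = (1 / 2 : ℝ) • c + (1 / 2 : ℝ) • c := by rw [← add_smul]; norm_num
    nth_rewrite 2 [this]
    module
  rw [h2, inner_smul_right] at h1
  have h3 := hT0 _ hmem
  have h4 := hTm x (hsub ⟨y', hy', rfl⟩)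
  linarith

open scoped Pointwise in
lemma card_mul_volume_le {T : Set (En n)} {m δ k : ℝ} (hm : 0 < m) {z e ν : En n}
    (hz : z ∈ T) (he : e ∈ T) (hν : ∀ y ∈ T, ⟪ν, y - z⟫ ≤ δ)
    (hν1 : ⟪ν, z - midpoint ℝ z e⟫ = 1) (hk : m / 2 ≤ k) (J : ℕ) (hJ : J * δ ≤ 1 / 4) (hδ : 0 < δ)
    (hQ : MeasurableSet {q : En n | ∀ y ∈ T, ⟪q, y - midpoint ℝ z e⟫ ≤ 2 * m}) :
    (J : ℝ≥0∞) * (ENNReal.ofReal ((1 / 16) ^ n) *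
      volume {q : En n | ∀ y ∈ T, ⟪q, y - midpoint ℝ z e⟫ ≤ 2 * m}) ≤
      volume {p : En n | ∀ y ∈ T, ⟪p, y - z⟫ < k} := by
  set c := midpoint ℝ z e with hc
  set Q := {q : En n | ∀ y ∈ T, ⟪q, y - c⟫ ≤ 2 * m} with hQdef
  have hcz : c - z = e - c := by
    rw [hc, midpoint_sub_left, right_sub_midpoint]
  have hbound : ∀ q ∈ Q, |⟪q, z - c⟫| ≤ 2 * m := by
    intro q hq
    rw [abs_le]
    refine ⟨?_, hq z hz⟩
    have := hq e he
    rw [← hcz, ← neg_sub, inner_neg_right] at this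
    linarith
  let F : ℕ → Set (En n) := fun j => (fun q => (j * m) • ν + q) '' ((1 / 16 : ℝ) • Q)
  have hF : ∀ j, volume (F j) = ENNReal.ofReal ((1 / 16) ^ n) * volume Q := by
    intro j
    simp only [F]
    rw [image_add_left, measure_preimage_add, Measure.addHaar_smul]
    simp
  have hFm : ∀ j, MeasurableSet (F j) := by
    intro j
    simp only [F]
    rw [image_add_left]
    exact (measurable_const_add _) (hQ.const_smul₀ _)
  have hsub : (⋃ j ∈ Finset.range J, F j) ⊆ {p : En n | ∀ y ∈ T, ⟪p, y - z⟫ < k} := by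
    intro p hp
    simp only [mem_iUnion, Finset.mem_range, exists_prop] at hp
    obtain ⟨j, hj, _, ⟨q, hq, rfl⟩, rfl⟩ := hp
    intro y hy
    have h1 := hν y hy
    have h2 := hq y hy
    have h3 := (abs_le.1 (hbound q hq)).1
    have h4 : ⟪q, y - z⟫ = ⟪q, y - c⟫ - ⟪q, z - c⟫ := by rw [← inner_sub_right]; congr 1; abel
    simp only [inner_add_left, inner_smul_left, RCLike.conj_to_real, h4]
    have hjJ : (j : ℝ) + 1 ≤ J := by exact_mod_cast hj
    have h5 : (j : ℝ) * m * ⟪ν, y - z⟫ ≤ j * m * δ :=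
      mul_le_mul_of_nonneg_left h1 (by positivity)
    have h6 : ((j : ℝ) + 1) * δ ≤ 1 / 4 := (mul_le_mul_of_nonneg_right hjJ hδ.le).trans hJ
    have h7 : (j : ℝ) * δ * m < 1 / 4 * m := mul_lt_mul_of_pos_right (by linarith) hm
    nlinarith
  have hdisj : Set.PairwiseDisjoint (↑(Finset.range J)) F := by
    intro i _ j _ hij
    refine Set.disjoint_left.2 ?_
    rintro _ ⟨_, ⟨q, hq, rfl⟩, rfl⟩ ⟨_, ⟨q', hq', rfl⟩, heq⟩
    have h := congrArg (fun p => ⟪p, z - c⟫) heq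
    simp only [inner_add_left, inner_smul_left, RCLike.conj_to_real, hν1, mul_one] at h
    have h1 := abs_le.1 (hbound q hq)
    have h2 := abs_le.1 (hbound q' hq')
    apply hij
    have h3 : |((i : ℝ) - j) * m| ≤ m / 4 := by rw [abs_le]; constructor <;> linarith
    rw [abs_mul, abs_of_pos hm] at h3
    have h4 : |(i : ℝ) - j| < 1 := by
      by_contra! h5
      nlinarith
    have h6 : |(i : ℤ) - j| < 1 := by exact_mod_cast h4
    rw [Int.abs_lt_one_iff] at h6
    omega
  calc (J : ℝ≥0∞) * (ENNReal.ofReal ((1 / 16) ^ n) * volume Q)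
      = ∑ j ∈ Finset.range J, volume (F j) := by simp [hF]
    _ = volume (⋃ j ∈ Finset.range J, F j) :=
        (measure_biUnion_finset hdisj fun j _ => hFm j).symm
    _ ≤ _ := measure_mono hsub

end Sections

section Caffarelli

variable {n : ℕ}

lemma frontier_affine_neg_absurd {Ω K : Set (En n)} (hΩ : IsOpen Ω) {u : En n → ℝ}
    (hu : ConvexOn ℝ Ω u) {lam Lam : ℝ} (hlam : 0 < lam)
    (hMA : ∀ s : Set (En n), s ⊆ Ω → MeasurableSet s →
      ENNReal.ofReal lam * volume s ≤ MAm Ω u s ∧ MAm Ω u s ≤ ENNReal.ofReal Lam * volume s)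
    (hK : IsCompact K) (hKc : Convex ℝ K) (hKΩ : K ⊆ Ω) (hu0 : ∀ x ∈ Ω, 0 ≤ u x)
    (g : En n) (t : ℝ) {x₀ y₁ : En n} (hx₀ : x₀ ∈ K) (hux₀ : u x₀ = 0) (hx₀t : t < ⟪g, x₀⟫)
    (hy₁ : y₁ ∈ K) (huy₁ : u y₁ = 0) (hy₁t : ⟪g, y₁⟫ < t)
    (hfr : ∀ x ∈ frontier K, u x = 0 → ⟪g, x⟫ < t) : False := by
  have hcu : ContinuousOn u K := (hu.continuousOn hΩ).mono hKΩ
  have huK : ConvexOn ℝ K u := hu.subset hKΩ hKc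
  set l : En n → ℝ := fun x => ⟪g, x⟫ - t with hl
  have hlc : Continuous l := by fun_prop
  set Z : Set (En n) := {x ∈ K | u x ≤ 0} with hZ
  have hZc : Convex ℝ Z := huK.convex_le 0
  have hZk : IsCompact Z := by
    have := hcu.preimage_isClosed_of_isClosed hK.isClosed (isClosed_Iic (a := (0 : ℝ)))
    exact hK.of_isClosed_subset this fun x hx => hx.1
  have hZ0 : ∀ x ∈ Z, u x = 0 := fun x hx => le_antisymm hx.2 (hu0 x (hKΩ hx.1))
  obtain ⟨z, hzZ, hz⟩ := hZk.exists_isMaxOn ⟨x₀, hx₀, hux₀.le⟩ hlc.continuousOn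
  set b := l z with hb
  have hbpos : 0 < b := by
    have h1 : l x₀ ≤ l z := hz (⟨hx₀, hux₀.le⟩ : x₀ ∈ Z)
    have h2 : 0 < l x₀ := by simp only [hl]; linarith
    linarith
  have hlin : ∀ x y : En n, ∀ s : ℝ, l (AffineMap.lineMap x y s) = (1 - s) * l x + s * l y := by
    intro x y s
    simp only [hl, AffineMap.lineMap_apply_module, inner_add_right, inner_smul_right]
    ring
  have hly₁ : l y₁ < 0 := by simp only [hl]; linarith
  obtain ⟨e, heZ, hle⟩ : ∃ e ∈ Z, l e = b / 2 := by
    refine ⟨AffineMap.lineMap z y₁ ((b / 2) / (b - l y₁)),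
      hZc.lineMap_mem hzZ ⟨hy₁, huy₁.le⟩ ⟨?_, ?_⟩, ?_⟩
    · exact div_nonneg (by linarith) (by linarith)
    · rw [div_le_one (by linarith)]; linarith
    · rw [hlin]
      have : b - l y₁ ≠ 0 := by linarith
      field_simp
      ring
  obtain ⟨J, hJ⟩ := exists_nat_gt (max 1 (Lam * 32 ^ n / lam))
  have hJ1 : (1 : ℝ) < J := (le_max_left _ _).trans_lt hJ
  have hJ2 : Lam * 32 ^ n < J * lam := by
    rw [← div_lt_iff₀ hlam]; exact (le_max_right _ _).trans_lt hJ
  set δ : ℝ := 1 / (4 * J) with hδ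
  have hδpos : 0 < δ := by positivity
  have hJδ : J * δ ≤ 1 / 4 := by rw [hδ]; apply le_of_eq; field_simp
  have hδ1 : δ ≤ 1 := by nlinarith
  set Cb : Set (En n) := {x ∈ K | (x ∈ frontier K ∧ 0 ≤ l x) ∨ b * (1 + δ / 4) ≤ l x} with hCb
  have hCbk : IsCompact Cb := by
    refine hK.inter_right ?_
    exact (isClosed_frontier.inter (isClosed_le continuous_const hlc)).union
      (isClosed_le continuous_const hlc)
  obtain ⟨κ, hκ, hκu⟩ : ∃ κ : ℝ, 0 < κ ∧ ∀ x ∈ Cb, κ ≤ u x := by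
    refine hCbk.exists_forall_le' (hcu.mono fun x hx => hx.1) ?_
    rintro x ⟨hxK, hx⟩
    refine lt_of_le_of_ne (hu0 x (hKΩ hxK)) fun h => ?_
    rcases hx with ⟨h1, h2⟩ | h1
    · have := hfr x h1 h.symm
      simp only [hl] at h2
      linarith
    · have h2 : l x ≤ l z := hz (⟨hxK, h.symm.le⟩ : x ∈ Z)
      nlinarith
  obtain ⟨M, hM⟩ := hK.bddAbove_image hlc.continuousOn
  have hM' : ∀ x ∈ K, l x ≤ |M| := fun x hx => (hM (mem_image_of_mem _ hx)).trans (le_abs_self _)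
  set η : ℝ := κ / (2 * (|M| + 1)) with hη
  have hMpos : 0 ≤ |M| := abs_nonneg M
  have hηpos : 0 < η := by positivity
  have hηM : η * |M| < κ := by
    rw [hη, div_mul_eq_mul_div, div_lt_iff₀ (by positivity)]
    nlinarith
  set U : En n → ℝ := fun y => u y - (⟪η • g, y⟫ + -(η * t)) with hU
  have hUl : ∀ x, U x = u x - η * l x := by
    intro x
    simp only [hU, hl, inner_smul_left, RCLike.conj_to_real]
    ring
  have hUc : ConvexOn ℝ Ω U := convexOn_sub_inner hu _ _
  have hUcont : ContinuousOn U Ω := hUc.continuousOn hΩ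
  set T : Set (En n) := {x ∈ K | U x ≤ 0} with hT
  have hTc : Convex ℝ T := (hUc.subset hKΩ hKc).convex_le 0
  have hTk : IsCompact T := by
    have := (hUcont.mono hKΩ).preimage_isClosed_of_isClosed hK.isClosed (isClosed_Iic (a := (0 : ℝ)))
    exact hK.of_isClosed_subset this fun x hx => hx.1
  have hTΩ : T ⊆ Ω := fun x hx => hKΩ hx.1
  have hTCb : ∀ x ∈ T, x ∉ Cb := by
    intro x hx hxC
    have h1 := hκu x hxC
    have h2 := hx.2
    rw [hUl] at h2
    have h3 := mul_le_mul_of_nonneg_left (hM' x hx.1) hηpos.le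
    linarith
  have hTl : ∀ x ∈ T, 0 ≤ l x := by
    intro x hx
    have h2 := hx.2
    rw [hUl] at h2
    have h3 := hu0 x (hTΩ hx)
    by_contra! h4
    nlinarith
  have hTint : ∀ x ∈ T, x ∈ interior K := by
    intro x hx
    by_contra h
    exact hTCb x hx ⟨hx.1, Or.inl ⟨⟨subset_closure hx.1, h⟩, hTl x hx⟩⟩
  have hTup : ∀ x ∈ T, l x < b * (1 + δ / 4) := by
    intro x hx
    by_contra! h
    exact hTCb x hx ⟨hx.1, Or.inr h⟩
  have hTn : ∀ x ∈ T, U x < 0 → T ∈ nhds x := by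
    intro x hx hUx
    have h1 : ∀ᶠ y in nhds x, U y < 0 :=
      (hUcont.continuousAt (hΩ.mem_nhds (hTΩ hx))).eventually (gt_mem_nhds hUx)
    filter_upwards [mem_interior_iff_mem_nhds.1 (hTint x hx), h1] with y hy hy'
    exact ⟨hy, hy'.le⟩
  have hUz : U z = -(η * b) := by rw [hUl, hZ0 z hzZ]; ring
  have hzT : z ∈ T := ⟨hzZ.1, by rw [hUz]; have := mul_pos hηpos hbpos; linarith⟩
  have heT : e ∈ T := ⟨heZ.1, by
    rw [hUl, hZ0 e heZ, hle]; have := mul_pos hηpos hbpos; linarith⟩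
  have hcT : midpoint ℝ z e ∈ T := hTc.midpoint_mem hzT heT
  have hlsub : ∀ x y, ⟪g, x - y⟫ = l x - l y := by
    intro x y; simp only [hl, inner_sub_right]; ring
  have hlc' : l (midpoint ℝ z e) = 3 / 4 * b := by
    rw [midpoint, hlin, hle]
    norm_num
    ring
  set m : ℝ := η * (b * (1 + δ / 4)) with hm
  have hmpos : 0 < m := by positivity
  have hQc : MeasurableSet {q : En n | ∀ y ∈ T, ⟪q, y - midpoint ℝ z e⟫ ≤ 2 * m} := by
    apply IsClosed.measurableSet
    simp only [ofPred_forall]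
    exact isClosed_biInter fun y _ => isClosed_le (by fun_prop) continuous_const
  have h1 := volume_le_of_contact hUc hΩ hTΩ hTk hTn hzT
  have h2 : ENNReal.ofReal lam * (ENNReal.ofReal ((1 / 2) ^ n) * volume T) ≤
      volume {q : En n | ∀ y ∈ T, ⟪q, y - midpoint ℝ z e⟫ ≤ 2 * m} := by
    refine le_volume_of_lower_bound (U := U) (fun s hs hsm => ?_) hTΩ hTk hTc (fun x hx => hx.2)
      (fun x hx => ?_) hcT
    · rw [hU, MAm_sub_inner]; exact (hMA s hs hsm).1
    · rw [hUl]
      have := hu0 x (hTΩ hx)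
      have := mul_le_mul_of_nonneg_left (hTup x hx).le hηpos.le
      linarith
  have h3 := card_mul_volume_le (k := - U z) (ν := (4 / b) • g) hmpos hzT heT (δ := δ) ?_ ?_ ?_ J hJδ
    hδpos hQc
  · have h4 : MAm Ω U T ≤ ENNReal.ofReal Lam * volume T := by
      rw [hU, MAm_sub_inner]; exact (hMA T hTΩ hTk.measurableSet).2
    have hV : volume T ≠ ∞ := hTk.measure_lt_top.ne
    have hV0 : 0 < (volume T).toReal := ENNReal.toReal_pos
      (Measure.measure_pos_of_mem_nhds volume (hTn z hzT (by
        rw [hUz]; have := mul_pos hηpos hbpos; linarith))).ne' hV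
    have h5 : (J : ℝ≥0∞) * (ENNReal.ofReal ((1 / 16) ^ n) *
        (ENNReal.ofReal lam * (ENNReal.ofReal ((1 / 2) ^ n) * volume T))) ≤
        ENNReal.ofReal Lam * volume T := by
      refine le_trans ?_ (h3.trans (h1.trans h4))
      gcongr
    have h6 := ENNReal.toReal_mono (ENNReal.mul_ne_top ENNReal.ofReal_ne_top hV) h5
    simp only [ENNReal.toReal_mul, ENNReal.toReal_natCast] at h6
    rw [ENNReal.toReal_ofReal (by positivity), ENNReal.toReal_ofReal hlam.le,
      ENNReal.toReal_ofReal (by positivity)] at h6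
    have hpow : ((1 : ℝ) / 16) ^ n * (1 / 2) ^ n * 32 ^ n = 1 := by
      rw [← mul_pow, ← mul_pow]; norm_num
    rcases le_or_gt 0 Lam with hL | hL
    · rw [ENNReal.toReal_ofReal hL] at h6
      have h7 : (J * lam * (((1 : ℝ) / 16) ^ n * (1 / 2) ^ n)) * (volume T).toReal
        ≤ Lam * (volume T).toReal := by linarith
      have h8 := le_of_mul_le_mul_right h7 hV0
      have h9 := mul_le_mul_of_nonneg_right h8 (by positivity : (0 : ℝ) ≤ 32 ^ n)
      rw [mul_assoc, hpow] at h9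
      linarith
    · rw [ENNReal.ofReal_of_nonpos hL.le] at h6
      have : 0 < (J : ℝ) * ((1 / 16) ^ n * (lam * ((1 / 2) ^ n * (volume T).toReal))) := by
        positivity
      simp only [ENNReal.toReal_zero, zero_mul] at h6
      linarith
  · intro y hy
    rw [inner_smul_left, hlsub, ← hb, RCLike.conj_to_real, div_mul_eq_mul_div,
      div_le_iff₀ hbpos]
    have := hTup y hy
    linarith
  · rw [inner_smul_left, hlsub, ← hb, hlc', RCLike.conj_to_real]
    field_simp
    norm_num
  · rw [hUz, hm]
    have : b * (1 + δ / 4) ≤ b * 2 := mul_le_mul_of_nonneg_left (by linarith) hbpos.le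
    have := mul_le_mul_of_nonneg_left this hηpos.le
    linarith

/-- The contact set of `u` with a supporting affine function has no extreme point in `Ω`,
unless it is a singleton. -/
lemma exists_mem_openSegment_of_eq_zero {Ω : Set (En n)} (hΩ : IsOpen Ω) {u : En n → ℝ}
    (hu : ConvexOn ℝ Ω u) {lam Lam : ℝ} (hlam : 0 < lam)
    (hMA : ∀ s : Set (En n), s ⊆ Ω → MeasurableSet s →
      ENNReal.ofReal lam * volume s ≤ MAm Ω u s ∧ MAm Ω u s ≤ ENNReal.ofReal Lam * volume s)
    (hu0 : ∀ x ∈ Ω, 0 ≤ u x) {x₀ y₀ : En n} (hx₀ : x₀ ∈ Ω) (hy₀ : y₀ ∈ Ω) (hne : y₀ ≠ x₀)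
    (hux₀ : u x₀ = 0) (huy₀ : u y₀ = 0) :
    ∃ a b, a ≠ b ∧ x₀ ∈ openSegment ℝ a b ∧ ∀ x ∈ segment ℝ a b, x ∈ Ω ∧ u x = 0 := by
  obtain ⟨ρ, hρ, hρΩ, hρy⟩ : ∃ ρ > 0, Metric.closedBall x₀ ρ ⊆ Ω ∧ ρ ≤ dist y₀ x₀ := by
    obtain ⟨ρ, hρ, h⟩ := Metric.nhds_basis_closedBall.mem_iff.1 (hΩ.mem_nhds hx₀)
    exact ⟨min ρ (dist y₀ x₀), lt_min hρ (dist_pos.2 hne),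
      (Metric.closedBall_subset_closedBall (min_le_left _ _)).trans h, min_le_right _ _⟩
  set K := Metric.closedBall x₀ ρ with hKdef
  have hKk : IsCompact K := isCompact_closedBall _ _
  have hKc : Convex ℝ K := convex_closedBall _ _
  have hcu : ContinuousOn u K := (hu.continuousOn hΩ).mono hρΩ
  set Z : Set (En n) := {x ∈ K | u x ≤ 0} with hZ
  have hZc : Convex ℝ Z := (hu.subset hρΩ hKc).convex_le 0
  have hZk : IsCompact Z := by
    have := hcu.preimage_isClosed_of_isClosed hKk.isClosed (isClosed_Iic (a := (0 : ℝ)))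
    exact hKk.of_isClosed_subset this fun x hx => hx.1
  have hZ0 : ∀ x ∈ Z, u x = 0 := fun x hx => le_antisymm hx.2 (hu0 x (hρΩ hx.1))
  have hx₀Z : x₀ ∈ Z := ⟨Metric.mem_closedBall_self hρ.le, hux₀.le⟩
  have hfrK : frontier K ⊆ K := Metric.isClosed_closedBall.frontier_subset
  by_cases hext : x₀ ∈ Z.extremePoints ℝ
  · exfalso
    have hx₀fr : x₀ ∉ frontier K := fun h =>
      h.2 (mem_interior_iff_mem_nhds.2 (Metric.closedBall_mem_nhds x₀ hρ))
    obtain ⟨D, hDk, hDc, hCD, hDZ⟩ := exists_isCompact_convex_of_mem_extremePoints hZc hZk hext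
      (C := Z ∩ frontier K) (hZk.inter_right isClosed_frontier)
      (by rintro x ⟨h1, h2⟩; exact ⟨h1, fun h => hx₀fr (h ▸ h2)⟩)
    obtain ⟨f, t, hft, htx⟩ := geometric_hahn_banach_closed_point hDc hDk.isClosed
      (fun h => (hDZ h).2 rfl : x₀ ∉ D)
    set g : En n := (InnerProductSpace.toDual ℝ (En n)).symm f with hg
    have hgf : ∀ x, ⟪g, x⟫ = f x := fun x => InnerProductSpace.toDual_symm_apply
    have hfrt : ∀ x ∈ frontier K, u x = 0 → ⟪g, x⟫ < t := fun x hx hux => by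
      rw [hgf]
      exact hft x (hCD ⟨⟨hfrK hx, hux.le⟩, hx⟩)
    have hd : 0 < dist y₀ x₀ := dist_pos.2 hne
    set y₁ := AffineMap.lineMap x₀ y₀ (ρ / dist y₀ x₀) with hy₁
    have hy₁d : dist y₁ x₀ = ρ := by
      rw [hy₁, dist_lineMap_left, Real.norm_of_nonneg (by positivity), dist_comm x₀]
      field_simp
    have hy₁K : y₁ ∈ K := Metric.mem_closedBall.2 hy₁d.le
    have hmem : y₁ ∈ {x ∈ Ω | u x ≤ 0} :=
      (hu.convex_le 0).lineMap_mem ⟨hx₀, hux₀.le⟩ ⟨hy₀, huy₀.le⟩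
        ⟨by positivity, (div_le_one hd).2 hρy⟩
    have huy₁ : u y₁ = 0 := hZ0 _ ⟨hy₁K, hmem.2⟩
    have hy₁fr : y₁ ∈ frontier K := by
      rw [hKdef, frontier_closedBall _ hρ.ne']
      exact hy₁d
    exact frontier_affine_neg_absurd hΩ hu hlam hMA hKk hKc hρΩ hu0 g t hx₀Z.1 hux₀
      (by rw [hgf]; exact htx) hy₁K huy₁ (hfrt _ hy₁fr huy₁) hfrt
  · rw [mem_extremePoints] at hext
    push Not at hext
    obtain ⟨a, ha, b, hb, hx, hab⟩ := hext hx₀Z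
    refine ⟨a, b, ?_, hx, fun x hx => ?_⟩
    · rintro rfl
      rw [openSegment_same] at hx
      exact hab hx.symm hx.symm
    · have := hZc.segment_subset ha hb hx
      exact ⟨hρΩ this.1, hZ0 _ this⟩

end Caffarelli

section Barrier

variable {n : ℕ}

/-- The linear map `v ↦ (v + c ⟪e, v⟫ e) / 2`. -/
def stretch (c : ℝ) (e : En n) : En n →ₗ[ℝ] En n :=
  (1 / 2 : ℝ) • LinearMap.transvection (c • (innerₛₗ ℝ e)) e

lemma stretch_apply (c : ℝ) (e v : En n) :
    stretch c e v = (1 / 2 : ℝ) • (v + (c * ⟪e, v⟫) • e) := by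
  simp [stretch, LinearMap.transvection.apply]

lemma inner_stretch (c : ℝ) (e p v : En n) : ⟪p, stretch c e v⟫ = ⟪stretch c e p, v⟫ := by
  simp only [stretch_apply, inner_smul_right, inner_smul_left, inner_add_right, inner_add_left,
    RCLike.conj_to_real, real_inner_comm]
  ring

lemma det_stretch (c : ℝ) (e : En n) :
    LinearMap.det (stretch c e) = (1 / 2) ^ n * (1 + c * ‖e‖ ^ 2) := by
  rw [stretch, LinearMap.det_smul, LinearMap.transvection.det]
  simp

lemma continuous_stretch (c : ℝ) (e : En n) : Continuous (stretch c e) :=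
  LinearMap.continuous_of_finiteDimensional _

/-- Stretching `u` along a segment on which it vanishes gives a lower barrier with large
Monge–Ampère measure. -/
lemma exists_barrier {Ω : Set (En n)} (hΩ : IsOpen Ω) {u : En n → ℝ}
    (hu : ConvexOn ℝ Ω u) {lam : ℝ} (hlam : 0 < lam)
    (hMA : ∀ s : Set (En n), s ⊆ Ω → MeasurableSet s → ENNReal.ofReal lam * volume s ≤ MAm Ω u s)
    {a b x₀ : En n} (hab : a ≠ b) (hx₀ : x₀ ∈ openSegment ℝ a b)
    (hseg : ∀ x ∈ segment ℝ a b, x ∈ Ω ∧ u x = 0) (Lam : ℝ) :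
    ∃ (W : Set (En n)) (w : En n → ℝ) (R : ℝ), IsOpen W ∧ ConvexOn ℝ W w ∧ 0 < R ∧
      Metric.closedBall x₀ R ⊆ W ∧ Metric.closedBall x₀ R ⊆ Ω ∧
      (∀ x ∈ Metric.closedBall x₀ R, w x ≤ u x) ∧ w x₀ = u x₀ ∧
      ∀ s ⊆ W, MeasurableSet s → ENNReal.ofReal Lam * volume s ≤ MAm W w s := by
  set e := b - a with he
  have hepos : 0 < ‖e‖ := norm_pos_iff.2 (sub_ne_zero.2 hab.symm)
  obtain ⟨c, hc0, hc⟩ : ∃ c : ℝ, 0 ≤ c ∧ Lam ≤ lam * ((1 / 2) ^ n * (1 + c * ‖e‖ ^ 2)) * 2 ^ n *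
      ((1 / 2) ^ n * (1 + c * ‖e‖ ^ 2)) := by
    refine ⟨|Lam| * 2 ^ n / (lam * ‖e‖ ^ 2), by positivity, ?_⟩
    set q := |Lam| * 2 ^ n / (lam * ‖e‖ ^ 2) * ‖e‖ ^ 2 with hq
    have hq0 : 0 ≤ q := by positivity
    have h1 : lam * q = |Lam| * 2 ^ n := by rw [hq]; field_simp
    have h2 : ((1 : ℝ) / 2) ^ n * 2 ^ n = 1 := by rw [← mul_pow]; norm_num
    have h3 : lam * ((1 / 2) ^ n * (1 + q)) * 2 ^ n * ((1 / 2) ^ n * (1 + q))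
      = lam * (1 + q) * (1 + q) * (1 / 2) ^ n * ((1 / 2) ^ n * 2 ^ n) := by ring
    rw [h3, h2]
    calc Lam ≤ |Lam| := le_abs_self _
      _ = lam * q * 1 * (1 / 2) ^ n := by rw [h1, mul_one, mul_assoc, mul_comm (2 ^ n), h2, mul_one]
      _ ≤ lam * (1 + q) * (1 + q) * (1 / 2) ^ n := by gcongr <;> linarith
      _ = _ := by ring
  set M := stretch c e with hM
  have hd : 0 < LinearMap.det M := by rw [hM, det_stretch]; positivity
  set A : En n → En n := fun x => x₀ + M (x - x₀) with hA
  have hAc : Continuous A := by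
    have := continuous_stretch c e
    fun_prop
  have hAsub : ∀ x y, A y - A x = M (y - x) := by
    intro x y
    simp only [hA, map_sub]
    abel
  have hAinj : Function.Injective A := by
    intro x y h
    have h1 : M (y - x) = M 0 := by rw [← hAsub, h, sub_self, map_zero]
    have h2 := (M.equivOfDetNeZero hd.ne').injective h1
    exact (sub_eq_zero.1 h2).symm
  have hAx₀ : A x₀ = x₀ := by simp [hA]
  have hx₀s := hseg x₀ (openSegment_subset_segment ℝ a b hx₀)
  have hWo : IsOpen (A ⁻¹' Ω) := hΩ.preimage hAc
  have hAcomb : ∀ x y : En n, ∀ s t : ℝ, s + t = 1 → A (s • x + t • y) = s • A x + t • A y := by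
    intro x y s t hst
    have h1 : s • x + t • y - x₀ = s • (x - x₀) + t • (y - x₀) := by
      have : x₀ = (s + t) • x₀ := by rw [hst, one_smul]
      nth_rewrite 1 [this]
      module
    simp only [hA, h1, map_add, map_smul]
    have : x₀ = (s + t) • x₀ := by rw [hst, one_smul]
    nth_rewrite 1 [this]
    module
  have hwc : ConvexOn ℝ (A ⁻¹' Ω) (fun x => 2 * u (A x)) := by
    refine ⟨fun x hx y hy s t hs ht hst => ?_, fun x hx y hy s t hs ht hst => ?_⟩
    · rw [mem_preimage, hAcomb x y s t hst]
      exact hu.1 hx hy hs ht hst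
    · have := hu.2 hx hy hs ht hst
      simp only [hAcomb x y s t hst, smul_eq_mul] at this ⊢
      linarith
  obtain ⟨ε, hε, hεseg⟩ : ∃ ε > 0, ∀ τ : ℝ, |τ| < ε → x₀ + τ • e ∈ segment ℝ a b := by
    rw [openSegment_eq_image_lineMap] at hx₀
    obtain ⟨θ, hθ, rfl⟩ := hx₀
    refine ⟨min θ (1 - θ), lt_min hθ.1 (by linarith [hθ.2]), fun τ hτ => ?_⟩
    rw [segment_eq_image_lineMap]
    have h1 := abs_lt.1 (hτ.trans_le (min_le_left _ _))
    have h2 := abs_lt.1 (hτ.trans_le (min_le_right _ _))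
    refine ⟨θ + τ, ⟨by linarith, by linarith⟩, ?_⟩
    simp only [AffineMap.lineMap_apply_module', he]
    module
  have hev : ∀ᶠ x in nhds x₀, x ∈ A ⁻¹' Ω ∧ x ∈ Ω ∧ |c * ⟪e, x - x₀⟫| < ε := by
    have h0 : x₀ ∈ A ⁻¹' Ω := by rw [mem_preimage, hAx₀]; exact hx₀s.1
    refine (hWo.eventually_mem h0).and ((hΩ.eventually_mem hx₀s.1).and ?_)
    have h1 : Continuous fun x : En n => |c * ⟪e, x - x₀⟫| := by fun_prop
    exact h1.continuousAt.eventually (gt_mem_nhds (by simpa using hε))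
  obtain ⟨R, hR, hRs⟩ := Metric.nhds_basis_closedBall.mem_iff.1 hev
  refine ⟨A ⁻¹' Ω, fun x => 2 * u (A x), R, hWo, hwc, hR, fun x hx => (hRs hx).1,
    fun x hx => (hRs hx).2.1, fun x hx => ?_, ?_, fun s hs hsm => ?_⟩
  · obtain ⟨-, h2, h3⟩ := hRs hx
    have h4 := hseg _ (hεseg _ h3)
    have h5 := hu.2 h2 h4.1 (by norm_num : (0 : ℝ) ≤ 1 / 2) (by norm_num : (0 : ℝ) ≤ 1 / 2)
      (by norm_num)
    have h6 : A x = (1 / 2 : ℝ) • x + (1 / 2 : ℝ) • (x₀ + (c * ⟪e, x - x₀⟫) • e) := by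
      simp only [hA, hM, stretch_apply]
      have : x₀ = (1 / 2 : ℝ) • x₀ + (1 / 2 : ℝ) • x₀ := by rw [← add_smul]; norm_num
      nth_rewrite 1 [this]
      module
    rw [← h6, h4.2] at h5
    simp only [smul_eq_mul, mul_zero, add_zero] at h5
    linarith
  · simp [hAx₀, hx₀s.2]
  · have hsub : M '' (((2 : ℝ) • (1 : En n →ₗ[ℝ] En n)) '' (⋃ y ∈ A '' s, subgrad Ω u y)) ⊆
        ⋃ x ∈ s, subgrad (A ⁻¹' Ω) (fun x => 2 * u (A x)) x := by
      rintro _ ⟨_, ⟨p, hp, rfl⟩, rfl⟩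
      simp only [mem_iUnion, exists_prop, exists_exists_and_eq_and, mem_image] at hp ⊢
      obtain ⟨x, hx, hp⟩ := hp
      refine ⟨x, hx, fun y hy => ?_⟩
      have := hp (A y) hy
      rw [hAsub, inner_stretch] at this
      have h2 : M (((2 : ℝ) • (1 : En n →ₗ[ℝ] En n)) p) = (2 : ℝ) • M p := map_smul M _ _
      rw [h2, inner_smul_left, RCLike.conj_to_real]
      linarith
    have himg : A '' s = (fun y => (x₀ - M x₀) + y) '' (M '' s) := by
      rw [image_image]
      refine image_congr fun x _ => ?_
      simp only [hA, map_sub]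
      abel
    have hvolA : volume (A '' s) = ENNReal.ofReal (LinearMap.det M) * volume s := by
      rw [himg, image_add_left, measure_preimage_add, Measure.addHaar_image_linearMap,
        abs_of_pos hd]
    have h1 := hMA (A '' s) (by rintro _ ⟨x, hx, rfl⟩; exact hs hx)
      (hsm.image_of_continuousOn_injOn hAc.continuousOn hAinj.injOn)
    refine le_trans ?_ (measure_mono hsub)
    rw [Measure.addHaar_image_linearMap, Measure.addHaar_image_linearMap, abs_of_pos hd,
      LinearMap.det_smul, map_one, mul_one, finrank_euclideanSpace_fin,
      abs_of_pos (by positivity)]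
    calc ENNReal.ofReal Lam * volume s
        ≤ ENNReal.ofReal (LinearMap.det M * (2 ^ n * (lam * LinearMap.det M))) * volume s := by
          gcongr
          rw [hM, det_stretch]
          linarith
      _ = ENNReal.ofReal (LinearMap.det M) * (ENNReal.ofReal (2 ^ n) *
            (ENNReal.ofReal lam * volume (A '' s))) := by
          rw [hvolA, ENNReal.ofReal_mul hd.le, ENNReal.ofReal_mul (by positivity),
            ENNReal.ofReal_mul hlam.le]
          ring
      _ ≤ _ := by gcongr; exact h1

end Barrier

section Conjugate

open Filter Topology
open scoped BoundedContinuousFunction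

variable {n : ℕ} {K : Set (En n)}

/-- The convex conjugate of a function on `K`. -/
def conj (z : K →ᵇ ℝ) (p : En n) : ℝ := ⨆ x : K, (⟪p, (x : En n)⟫ - z x)

variable [CompactSpace K]

lemma bddAbove_conj (z : K →ᵇ ℝ) (p : En n) :
    BddAbove (range fun x : K => ⟪p, (x : En n)⟫ - z x) :=
  (isCompact_range (by fun_prop : Continuous fun x : K => ⟪p, (x : En n)⟫ - z x)).bddAbove

lemma le_conj (z : K →ᵇ ℝ) (p : En n) (x : K) : ⟪p, (x : En n)⟫ - z x ≤ conj z p :=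
  le_ciSup (bddAbove_conj z p) x

variable [Nonempty K]

lemma exists_eq_conj (z : K →ᵇ ℝ) (p : En n) : ∃ x : K, ⟪p, (x : En n)⟫ - z x = conj z p := by
  obtain ⟨x, -, hx⟩ := isCompact_univ.exists_isMaxOn univ_nonempty
    (by fun_prop : Continuous fun x : K => ⟪p, (x : En n)⟫ - z x).continuousOn
  exact ⟨x, le_antisymm (le_conj z p x) (ciSup_le fun y => hx (mem_univ y))⟩

lemma conj_le_add_norm (z z' : K →ᵇ ℝ) (p : En n) : conj z p ≤ conj z' p + ‖z' - z‖ := by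
  obtain ⟨x, hx⟩ := exists_eq_conj z p
  have h1 := le_conj z' p x
  have h2 := (z' - z).norm_coe_le_norm x
  rw [Real.norm_eq_abs, BoundedContinuousFunction.sub_apply] at h2
  have h3 := le_of_abs_le h2
  linarith

lemma exists_lipschitzWith_conj (z : K →ᵇ ℝ) : ∃ C, LipschitzWith C (conj z) := by
  obtain ⟨C, hC⟩ := (isCompact_iff_compactSpace.2 (inferInstance : CompactSpace K)).isBounded.exists_norm_le
  refine ⟨C.toNNReal, LipschitzWith.of_le_add_mul _ fun p q => ?_⟩
  obtain ⟨x, hx⟩ := exists_eq_conj z p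
  have h1 := le_conj z q x
  have h2 : ⟪p, (x : En n)⟫ - ⟪q, (x : En n)⟫ ≤ C * dist p q := by
    rw [← inner_sub_left, dist_eq_norm, mul_comm]
    exact (real_inner_le_norm _ _).trans (mul_le_mul_of_nonneg_left (hC x x.2) (norm_nonneg _))
  have h3 : C * dist p q ≤ C.toNNReal * dist p q :=
    mul_le_mul_of_nonneg_right (Real.le_coe_toNNReal C) dist_nonneg
  linarith

lemma continuous_conj (z : K →ᵇ ℝ) : Continuous (conj z) :=
  (exists_lipschitzWith_conj z).choose_spec.continuous

lemma exists_contact (z : K →ᵇ ℝ) : ∃ X : En n → K, Measurable X ∧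
    ∀ᵐ p ∂volume, ∀ x : K, ⟪p, (x : En n)⟫ - z x = conj z p ↔ X p = x := by
  have hKm : MeasurableSet K :=
    (isCompact_iff_compactSpace.2 (inferInstance : CompactSpace K)).measurableSet
  obtain ⟨g, hg, hgid⟩ := (MeasurableEmbedding.subtype_coe hKm).exists_measurable_extend
    (measurable_id (α := K)) fun _ => inferInstance
  refine ⟨fun p => g ((InnerProductSpace.toDual ℝ (En n)).symm (fderiv ℝ (conj z) p)),
    hg.comp ((InnerProductSpace.toDual ℝ (En n)).symm.continuous.measurable.comp
      (measurable_fderiv ℝ _)), ?_⟩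
  obtain ⟨C, hC⟩ := exists_lipschitzWith_conj z
  filter_upwards [hC.ae_differentiableAt] with p hp
  have key : ∀ x : K, ⟪p, (x : En n)⟫ - z x = conj z p →
      g ((InnerProductSpace.toDual ℝ (En n)).symm (fderiv ℝ (conj z) p)) = x := by
    intro x hx
    have h1 : IsLocalMin (fun q => conj z q - InnerProductSpace.toDual ℝ (En n) x q) p := by
      refine Eventually.of_forall fun q => ?_
      have := le_conj z q x
      simp only [InnerProductSpace.toDual_apply_apply, real_inner_comm q, real_inner_comm p]
      linarith
    have h2 := h1.hasFDerivAt_eq_zero (hp.hasFDerivAt.sub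
      (InnerProductSpace.toDual ℝ (En n) x).hasFDerivAt)
    rw [sub_eq_zero.1 h2, LinearIsometryEquiv.symm_apply_apply]
    exact congrFun hgid x
  intro x
  refine ⟨key x, fun h => ?_⟩
  obtain ⟨x', hx'⟩ := exists_eq_conj z p
  rw [← h, key x' hx', hx']

/-- The almost everywhere unique point where the supremum defining `conj z p` is attained. -/
def contact (z : K →ᵇ ℝ) : En n → K := (exists_contact z).choose

lemma measurable_contact (z : K →ᵇ ℝ) : Measurable (contact z) := (exists_contact z).choose_spec.1

lemma ae_eq_conj_iff (z : K →ᵇ ℝ) :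
    ∀ᵐ p ∂volume, ∀ x : K, ⟪p, (x : En n)⟫ - z x = conj z p ↔ contact z p = x :=
  (exists_contact z).choose_spec.2

lemma ae_eq_conj (z : K →ᵇ ℝ) :
    ∀ᵐ p ∂volume, ⟪p, (contact z p : En n)⟫ - z (contact z p) = conj z p :=
  (ae_eq_conj_iff z).mono fun _ h => (h _).2 rfl

lemma ae_tendsto_contact {v : K →ᵇ ℝ} {vk : ℕ → K →ᵇ ℝ} (h : Tendsto vk atTop (𝓝 v)) :
    ∀ᵐ p ∂volume, Tendsto (fun k => contact (vk k) p) atTop (𝓝 (contact v p)) := by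
  filter_upwards [ae_eq_conj_iff v, ae_all_iff.2 fun k => ae_eq_conj (vk k)] with p hp hk
  refine tendsto_nhds_of_unique_mapClusterPt fun y hy => ((hp y).1 ?_).symm
  have hc : Continuous fun x : K => ⟪p, (x : En n)⟫ - v x := by fun_prop
  have h1 : MapClusterPt (⟪p, (y : En n)⟫ - v y) atTop
      ((fun x : K => ⟪p, (x : En n)⟫ - v x) ∘ fun k => contact (vk k) p) :=
    hy.continuousAt_comp hc.continuousAt
  have h2 : Tendsto (fun k => conj v p - 2 * ‖vk k - v‖) atTop (𝓝 (conj v p)) := by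
    have := (tendsto_iff_norm_sub_tendsto_zero.1 h).const_mul 2
    simpa using tendsto_const_nhds.sub this
  have h3 : Tendsto ((fun x : K => ⟪p, (x : En n)⟫ - v x) ∘ fun k => contact (vk k) p) atTop
      (𝓝 (conj v p)) := by
    refine tendsto_of_tendsto_of_tendsto_of_le_of_le h2 tendsto_const_nhds (fun k => ?_)
      (fun k => le_conj v p _)
    have h4 := conj_le_add_norm v (vk k) p
    have h5 := (vk k - v).norm_coe_le_norm (contact (vk k) p)
    rw [Real.norm_eq_abs, BoundedContinuousFunction.sub_apply] at h5
    have h6 := neg_le_of_abs_le h5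
    have h7 := hk k
    simp only [Function.comp_apply]
    linarith
  have h4 : (𝓝 (⟪p, (y : En n)⟫ - v y) ⊓ 𝓝 (conj v p)).NeBot :=
    Filter.NeBot.mono h1 (inf_le_inf_left _ h3)
  exact eq_of_nhds_neBot h4

end Conjugate

section Variation

open Filter Topology
open scoped BoundedContinuousFunction

/-- Two finite measures can be compared on `{α > 0}` by testing against continuous functions
between `0` and `α`. -/
lemma measure_le_of_integral_le {X : Type*} [MetricSpace X] [CompactSpace X] [MeasurableSpace X]
    [BorelSpace X] (μ₁ μ₂ : Measure X) [IsFiniteMeasure μ₁] [IsFiniteMeasure μ₂] (α : X →ᵇ ℝ)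
    (h : ∀ η : X →ᵇ ℝ, (∀ x, 0 ≤ η x) → (∀ x, η x ≤ α x) → ∫ x, η x ∂μ₁ ≤ ∫ x, η x ∂μ₂)
    {E : Set X} (hE : MeasurableSet E) (hα : ∀ x ∈ E, 0 < α x) (hα0 : ∀ x, 0 ≤ α x) :
    μ₁ E ≤ μ₂ E := by
  refine ENNReal.le_of_forall_pos_le_add fun ε hε _ => ?_
  have hε' : (ε : ℝ≥0∞) / 2 ≠ 0 := by simp [hε.ne']
  obtain ⟨F, hFE, hF, hFμ⟩ := hE.exists_isCompact_lt_add (measure_ne_top μ₁ E) hε'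
  obtain ⟨O, hEO, hO, hOμ⟩ := E.exists_isOpen_lt_add (μ := μ₂) (measure_ne_top μ₂ E) hε'
  obtain ⟨c, hc, hcα⟩ := hF.exists_forall_le' α.continuous.continuousOn fun x hx => hα x (hFE hx)
  obtain ⟨f, hf0, hf1, hf⟩ := exists_continuous_zero_one_of_isClosed hO.isClosed_compl hF.isClosed
    (disjoint_left.2 fun x hx hx' => hx (hEO (hFE hx')))
  set η : X →ᵇ ℝ := BoundedContinuousFunction.mkOfCompact
    ⟨fun x => min (α x) (c * f x), by fun_prop⟩ with hη
  have hηx : ∀ x, η x = min (α x) (c * f x) := fun x => rfl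
  have h1 := h η (fun x => le_min (hα0 x) (mul_nonneg hc.le (hf x).1)) fun x => min_le_left _ _
  have h2 : c * μ₁.real F ≤ ∫ x, η x ∂μ₁ := by
    rw [mul_comm, ← smul_eq_mul, ← integral_indicator_const c hF.measurableSet]
    refine integral_mono ((integrable_const c).indicator hF.measurableSet) (η.integrable μ₁)
      fun x => ?_
    by_cases hx : x ∈ F
    · have h3 := hf1 hx
      simp only [Pi.one_apply] at h3
      simp [hx, hηx, h3, hcα x hx]
    · simp only [hx, not_false_eq_true, indicator_of_notMem, hηx]
      exact le_min (hα0 x) (mul_nonneg hc.le (hf x).1)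
  have h3 : ∫ x, η x ∂μ₂ ≤ c * μ₂.real O := by
    rw [mul_comm, ← smul_eq_mul, ← integral_indicator_const c hO.measurableSet]
    refine integral_mono (η.integrable μ₂) ((integrable_const c).indicator hO.measurableSet)
      fun x => ?_
    by_cases hx : x ∈ O
    · simp only [hx, indicator_of_mem, hηx]
      exact (min_le_right _ _).trans (mul_le_of_le_one_right hc.le (hf x).2)
    · have h3 := hf0 hx
      simp only [Pi.zero_apply] at h3
      simp [hx, hηx, h3]
  have h4 : μ₁.real F ≤ μ₂.real O := le_of_mul_le_mul_left (h2.trans (h1.trans h3)) hc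
  have h5 : μ₁ F ≤ μ₂ O := (ENNReal.toReal_le_toReal (measure_ne_top _ _) (measure_ne_top _ _)).1 h4
  calc μ₁ E ≤ μ₁ F + ε / 2 := hFμ.le
    _ ≤ (μ₂ E + ε / 2) + ε / 2 := by gcongr; exact h5.trans hOμ.le
    _ = μ₂ E + ε := by rw [add_assoc, ENNReal.add_halves]

variable {n : ℕ} {K : Set (En n)} [CompactSpace K] [Nonempty K]

lemma integrable_comp_contact (P : Set (En n)) (hP : IsCompact P) (u z : K →ᵇ ℝ) :
    Integrable (fun p => z (contact u p)) (volume.restrict P) := by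
  have : IsFiniteMeasure (volume.restrict P) := ⟨by simpa using hP.measure_lt_top⟩
  exact (integrable_const ‖z‖).mono' (z.continuous.measurable.comp
    (measurable_contact u)).aestronglyMeasurable (Eventually.of_forall fun p => z.norm_coe_le_norm _)

lemma integrable_conj (P : Set (En n)) (hP : IsCompact P) (z : K →ᵇ ℝ) :
    Integrable (conj z) (volume.restrict P) :=
  (continuous_conj z).continuousOn.integrableOn_compact hP

lemma integrable_add_conj (P : Set (En n)) (hP : IsCompact P) (u z : K →ᵇ ℝ) :
    Integrable (fun p => z (contact u p) + conj z p) (volume.restrict P) :=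
  (integrable_comp_contact P hP u z).add (integrable_conj P hP z)

/-- The functional whose minimizers have prescribed Monge–Ampère measure. -/
def functional (P : Set (En n)) (u z : K →ᵇ ℝ) : ℝ :=
  ∫ p in P, (z (contact u p) + conj z p)

lemma exists_functional_le (P : Set (En n)) (hP : IsCompact P) (u : K →ᵇ ℝ) {A : Set (K →ᵇ ℝ)}
    (hA : IsCompact A) (hAn : A.Nonempty) :
    ∃ v ∈ A, ∀ z ∈ A, functional P u v ≤ functional P u z := by
  suffices hc : Continuous (functional P u) from hA.exists_isMinOn hAn hc.continuousOn
  have : IsFiniteMeasure (volume.restrict P) := ⟨by simpa using hP.measure_lt_top⟩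
  refine (LipschitzWith.of_le_add_mul (Real.toNNReal (2 * (volume.restrict P).real univ))
    fun z z' => ?_).continuous
  have hi := integrable_add_conj P hP u
  have h1 : functional P u z ≤
      ∫ p in P, ((z' (contact u p) + conj z' p) + 2 * ‖z - z'‖) := by
    refine integral_mono (hi z) ((hi z').add (integrable_const _)) fun p => ?_
    have h2 := conj_le_add_norm z z' p
    have h3 := (z - z').norm_coe_le_norm (contact u p)
    rw [Real.norm_eq_abs, BoundedContinuousFunction.sub_apply] at h3
    have h4 := le_of_abs_le h3
    rw [norm_sub_rev] at h2
    linarith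
  rw [integral_add (hi z') (integrable_const _), integral_const, smul_eq_mul] at h1
  rw [Real.coe_toNNReal _ (by positivity), dist_eq_norm]
  refine h1.trans (le_of_eq ?_)
  simp only [functional]
  ring

/-- First variation of the functional at a minimizer. -/
lemma integral_contact_le (P : Set (En n)) (hP : IsCompact P) {u v η : K →ᵇ ℝ} {A : Set (K →ᵇ ℝ)}
    (hv : ∀ z ∈ A, functional P u v ≤ functional P u z)
    (hη : ∀ t : ℝ, 0 < t → t ≤ 1 → ∃ z ∈ A, (∀ x, z x ≤ v x + t * η x) ∧
      ∀ p ∈ P, conj z p ≤ conj (v + t • η) p) :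
    ∫ p in P, η (contact v p) ≤ ∫ p in P, η (contact u p) := by
  have : IsFiniteMeasure (volume.restrict P) := ⟨by simpa using hP.measure_lt_top⟩
  have key : ∀ t : ℝ, 0 < t → t ≤ 1 →
      ∫ p in P, η (contact (v + t • η) p) ≤ ∫ p in P, η (contact u p) := by
    intro t ht ht1
    obtain ⟨z, hzA, hz, hzP⟩ := hη t ht ht1
    have hi : Integrable (fun p => η (contact u p) - η (contact (v + t • η) p))
        (volume.restrict P) :=
      (integrable_comp_contact P hP u η).sub (integrable_comp_contact P hP (v + t • η) η)
    have h1 : functional P u z ≤ ∫ p in P, ((v (contact u p) + conj v p) +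
        t * (η (contact u p) - η (contact (v + t • η) p))) := by
      refine integral_mono_ae (integrable_add_conj P hP u z)
        ((integrable_add_conj P hP u v).add (hi.const_mul t)) ?_
      filter_upwards [ae_restrict_of_ae (ae_eq_conj (v + t • η)),
        ae_restrict_mem hP.measurableSet] with p hp hpP
      have h2 := hz (contact u p)
      have h3 := hzP p hpP
      have h4 := le_conj v p (contact (v + t • η) p)
      simp only [BoundedContinuousFunction.add_apply, BoundedContinuousFunction.smul_apply,
        smul_eq_mul] at hp
      linarith
    rw [integral_add (integrable_add_conj P hP u v) (hi.const_mul t), integral_const_mul,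
      integral_sub (integrable_comp_contact P hP u η)
        (integrable_comp_contact P hP (v + t • η) η)] at h1
    have h5 := (hv z hzA).trans h1
    simp only [functional] at h5
    have h6 : 0 ≤ t * ((∫ p in P, η (contact u p)) - ∫ p in P, η (contact (v + t • η) p)) := by
      linarith
    have := nonneg_of_mul_nonneg_right h6 ht
    linarith
  have hlim : Tendsto (fun k : ℕ => v + (1 / ((k : ℝ) + 1)) • η) atTop (𝓝 v) := by
    have := (tendsto_one_div_add_atTop_nhds_zero_nat (𝕜 := ℝ)).smul_const η
    simpa using this.const_add v
  refine le_of_tendsto' (tendsto_integral_of_dominated_convergence (fun _ => ‖η‖)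
    (fun k => (integrable_comp_contact P hP (v + (1 / ((k : ℝ) + 1)) • η) η).aestronglyMeasurable)
    (integrable_const _) (fun k => Eventually.of_forall fun p => η.norm_coe_le_norm _)
    (ae_restrict_of_ae ?_)) fun k => key _ (by positivity) ?_
  · filter_upwards [ae_tendsto_contact hlim] with p hp
    exact (η.continuous.tendsto _).comp hp
  · rw [div_le_one (by positivity)]
    linarith [(Nat.cast_nonneg k : (0 : ℝ) ≤ k)]

end Variation

section Prescribed

open Filter Topology
open scoped BoundedContinuousFunction

variable {n : ℕ} {K : Set (En n)}

/-- `z` has at each point of `K` a supporting affine function of slope at most `ρ`. -/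
def IsSupported (ρ : ℝ) (z : K → ℝ) : Prop :=
  ∀ x : K, ∃ p : En n, ‖p‖ ≤ ρ ∧ ∀ x' : K, z x + ⟪p, (x' : En n) - x⟫ ≤ z x'

/-- Convexity of a function on `K`. -/
def IsConvexFun (z : K → ℝ) : Prop :=
  ∀ x x' m : K, ∀ a b : ℝ, 0 ≤ a → 0 ≤ b → a + b = 1 → (m : En n) = a • (x : En n) + b • (x' : En n) →
    z m ≤ a * z x + b * z x'

lemma IsSupported.lipschitzWith {ρ : ℝ} {z : K → ℝ} (h : IsSupported ρ z) :
    LipschitzWith ρ.toNNReal z := by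
  refine LipschitzWith.of_le_add_mul _ fun x x' => ?_
  obtain ⟨p, hp, hpx⟩ := h x
  have h1 := hpx x'
  have h2 := abs_le.1 (abs_real_inner_le_norm p ((x' : En n) - x))
  have h3 : ‖p‖ * ‖(x' : En n) - x‖ ≤ ρ.toNNReal * dist x x' := by
    rw [dist_comm, Subtype.dist_eq, dist_eq_norm]
    exact mul_le_mul_of_nonneg_right (hp.trans (Real.le_coe_toNNReal ρ)) (norm_nonneg _)
  linarith

lemma IsSupported.isConvexFun {ρ : ℝ} {z : K → ℝ} (h : IsSupported ρ z) : IsConvexFun z := by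
  intro x x' m a b ha hb hab hm
  obtain ⟨p, -, hp⟩ := h m
  have h1 := mul_le_mul_of_nonneg_left (hp x) ha
  have h2 := mul_le_mul_of_nonneg_left (hp x') hb
  have h3 : a * ⟪p, (x : En n) - m⟫ + b * ⟪p, (x' : En n) - m⟫ = 0 := by
    rw [← inner_smul_right, ← inner_smul_right, ← inner_add_right]
    have : a • ((x : En n) - m) + b • ((x' : En n) - m) = 0 := by
      rw [smul_sub, smul_sub, sub_add_sub_comm, ← hm, ← add_smul, hab, one_smul, sub_self]
    rw [this, inner_zero_right]
  have h4 : z m = a * z m + b * z m := by rw [← add_mul, hab, one_mul]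
  linarith

/-- The convex functions between `w` and `u` that agree with `w` at `y`. -/
def admissible (ρ : ℝ) (w u : K →ᵇ ℝ) (y : K) : Set (K →ᵇ ℝ) :=
  {z | (∀ x, w x ≤ z x) ∧ (∀ x, z x ≤ u x) ∧ z y ≤ w y ∧ LipschitzWith ρ.toNNReal z ∧
    IsConvexFun z}

variable [CompactSpace K]

lemma isCompact_admissible (ρ : ℝ) (w u : K →ᵇ ℝ) (y : K) : IsCompact (admissible ρ w u y) := by
  have hev : ∀ x : K, Continuous fun z : K →ᵇ ℝ => z x := fun x =>
    continuous_eval_const x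
  refine BoundedContinuousFunction.arzela_ascoli₂ (Icc (-‖w‖) ‖u‖) isCompact_Icc _ ?_ ?_ ?_
  · simp only [admissible, lipschitzWith_iff_dist_le_mul, IsConvexFun, ofPred_and, ofPred_forall]
    refine (isClosed_iInter fun x => isClosed_le continuous_const (hev x)).inter
      ((isClosed_iInter fun x => isClosed_le (hev x) continuous_const).inter
      ((isClosed_le (hev y) continuous_const).inter
      ((isClosed_iInter fun x => isClosed_iInter fun x' =>
        isClosed_le ((hev x).dist (hev x')) continuous_const).inter ?_)))
    refine isClosed_iInter fun x => isClosed_iInter fun x' => isClosed_iInter fun m =>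
      isClosed_iInter fun a => isClosed_iInter fun b => isClosed_iInter fun _ =>
      isClosed_iInter fun _ => isClosed_iInter fun _ => isClosed_iInter fun _ =>
      isClosed_le (hev m) (((hev x).const_mul a).add ((hev x').const_mul b))
  · intro z x hz
    have h1 := abs_le.1 (w.norm_coe_le_norm x)
    have h2 := abs_le.1 (u.norm_coe_le_norm x)
    exact ⟨h1.1.trans (hz.1 x), (hz.2.1 x).trans h2.2⟩
  · exact (LipschitzWith.uniformEquicontinuous _ ρ.toNNReal
      fun z : admissible ρ w u y => z.2.2.2.2.1).equicontinuous

variable [Nonempty K]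

/-- The largest function below `f` with slopes in the ball of radius `ρ`. -/
lemma exists_isSupported_le (f : K →ᵇ ℝ) {ρ : ℝ} (hρ : 0 ≤ ρ) :
    ∃ z : K →ᵇ ℝ, IsSupported ρ z ∧ (∀ x, z x ≤ f x) ∧
      (∀ p ∈ Metric.closedBall (0 : En n) ρ, conj z p ≤ conj f p) ∧
      ∀ w : K → ℝ, IsSupported ρ w → (∀ x, w x ≤ f x) → ∀ x, w x ≤ z x := by
  have hex : ∀ x : K, ∃ p ∈ Metric.closedBall (0 : En n) ρ,
      ∀ q ∈ Metric.closedBall (0 : En n) ρ,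
        ⟪q, (x : En n)⟫ - conj f q ≤ ⟪p, (x : En n)⟫ - conj f p := by
    intro x
    have hc : Continuous fun p : En n => ⟪p, (x : En n)⟫ - conj f p := by
      have := continuous_conj f
      fun_prop
    exact (isCompact_closedBall (0 : En n) ρ).exists_isMaxOn
      ⟨0, Metric.mem_closedBall_self hρ⟩ hc.continuousOn
  choose p hpP hp using hex
  have hz : IsSupported ρ fun x : K => ⟪p x, (x : En n)⟫ - conj f (p x) := by
    refine fun x => ⟨p x, mem_closedBall_zero_iff.1 (hpP x), fun x' => ?_⟩
    have := hp x' (p x) (hpP x)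
    rw [inner_sub_right]
    linarith
  refine ⟨BoundedContinuousFunction.mkOfCompact ⟨_, hz.lipschitzWith.continuous⟩, hz,
    fun x => ?_, fun q hq => ?_, fun w hw hwf x => ?_⟩
  · have := le_conj f (p x) x
    simp only [BoundedContinuousFunction.mkOfCompact_apply, ContinuousMap.coe_mk]
    linarith
  · refine ciSup_le fun x => ?_
    have := hp x q hq
    simp only [BoundedContinuousFunction.mkOfCompact_apply, ContinuousMap.coe_mk]
    linarith
  · obtain ⟨q, hq, hqw⟩ := hw x
    have h1 := hp x q (mem_closedBall_zero_iff.2 hq)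
    have h2 : conj f q ≤ ⟪q, (x : En n)⟫ - w x := by
      refine ciSup_le fun x' => ?_
      have h3 := hqw x'
      have h4 := hwf x'
      rw [inner_sub_right] at h3
      linarith
    simp only [BoundedContinuousFunction.mkOfCompact_apply, ContinuousMap.coe_mk]
    linarith

/-- The Monge–Ampère measure of `z`, as the image of Lebesgue measure on a ball of slopes. -/
def contactMeasure (ρ : ℝ) (z : K →ᵇ ℝ) : Measure K :=
  (volume.restrict (Metric.closedBall (0 : En n) ρ)).map (contact z)

instance (ρ : ℝ) (z : K →ᵇ ℝ) : IsFiniteMeasure (contactMeasure ρ z) := by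
  have : IsFiniteMeasure (volume.restrict (Metric.closedBall (0 : En n) ρ)) :=
    ⟨by simpa using measure_closedBall_lt_top⟩
  unfold contactMeasure
  infer_instance

lemma integral_contactMeasure (ρ : ℝ) (z η : K →ᵇ ℝ) :
    ∫ x, η x ∂(contactMeasure ρ z) = ∫ p in Metric.closedBall (0 : En n) ρ, η (contact z p) :=
  integral_map (measurable_contact z).aemeasurable η.continuous.measurable.aestronglyMeasurable

lemma contactMeasure_le_of_eq (ρ : ℝ) {z z' : K →ᵇ ℝ} (h : ∀ x, z x ≤ z' x) {E : Set K}
    (hE : MeasurableSet E) (hEz : ∀ x ∈ E, z x = z' x) :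
    contactMeasure ρ z E ≤ contactMeasure ρ z' E := by
  unfold contactMeasure
  rw [Measure.map_apply (measurable_contact z) hE, Measure.map_apply (measurable_contact z') hE]
  refine measure_mono_ae (ae_restrict_of_ae ?_)
  filter_upwards [ae_eq_conj z, ae_eq_conj_iff z'] with p hp hp' hpE
  have h1 : contact z' p = contact z p := by
    refine (hp' _).1 (le_antisymm (le_conj z' p _) ?_)
    rw [← hEz _ hpE, hp]
    refine ciSup_le fun x => ?_
    have := le_conj z p x
    have := h x
    linarith
  change contact z' p ∈ E
  rw [h1]
  exact hpE

/-- A convex function between `w` and `u`, equal to `w` at a boundary point `y`, with the same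
Monge–Ampère measure as `u`. -/
lemma exists_contactMeasure_eq {ρ : ℝ} (hρ : 0 ≤ ρ) {u w : K →ᵇ ℝ} (hwu : ∀ x, w x ≤ u x)
    (hw : IsSupported ρ w) (y : K) (β : K →ᵇ ℝ) (hβ : ∀ x, 0 ≤ β x) (hβy : β y = 0)
    (hμ : ∀ E : Set K, MeasurableSet E → (∀ x ∈ E, 0 < β x) →
      contactMeasure ρ u E ≤ contactMeasure ρ w E) :
    ∃ v ∈ admissible ρ w u y, ∀ E : Set K, MeasurableSet E → (∀ x ∈ E, 0 < β x) →
      contactMeasure ρ v E = contactMeasure ρ u E := by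
  have hP := isCompact_closedBall (0 : En n) ρ
  obtain ⟨v, hvA, hv⟩ := exists_functional_le _ hP u (isCompact_admissible ρ w u y)
    ⟨w, fun _ => le_rfl, hwu, le_rfl, hw.lipschitzWith, hw.isConvexFun⟩
  have hvar : ∀ η : K →ᵇ ℝ, (∀ t : ℝ, 0 < t → t ≤ 1 → ∀ x, w x ≤ v x + t * η x ∧
      v x + t * η x ≤ u x) → η y ≤ 0 →
      ∫ x, η x ∂(contactMeasure ρ v) ≤ ∫ x, η x ∂(contactMeasure ρ u) := by
    intro η hη hηy
    rw [integral_contactMeasure, integral_contactMeasure]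
    refine integral_contact_le _ hP hv fun t ht ht1 => ?_
    obtain ⟨z, hz, hzf, hzP, hzw⟩ := exists_isSupported_le (v + t • η) hρ
    have hzw' := hzw w hw fun x => (hη t ht ht1 x).1
    refine ⟨z, ⟨hzw', fun x => (hzf x).trans (hη t ht ht1 x).2, ?_, hz.lipschitzWith,
      hz.isConvexFun⟩, hzf, hzP⟩
    have h1 : z y ≤ v y + t * η y := hzf y
    have h2 := hvA.2.2.1
    have h3 := mul_nonpos_of_nonneg_of_nonpos ht.le hηy
    linarith
  refine ⟨v, hvA, fun E hE hEβ => ?_⟩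
  have hup : ∀ E : Set K, MeasurableSet E → (∀ x ∈ E, 0 < β x) → (∀ x ∈ E, v x < u x) →
      contactMeasure ρ v E ≤ contactMeasure ρ u E := by
    intro E hE hEβ hEu
    refine measure_le_of_integral_le _ _ (β ⊓ (u - v)) (fun η h0 h1 => ?_) hE
      (fun x hx => lt_min (hEβ x hx) (sub_pos.2 (hEu x hx)))
      fun x => le_min (hβ x) (sub_nonneg.2 (hvA.2.1 x))
    refine hvar η (fun t ht ht1 x => ?_) (((h1 y).trans (min_le_left _ _)).trans hβy.le)
    have h2 : η x ≤ u x - v x := (h1 x).trans (min_le_right _ _)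
    have h3 := mul_nonneg ht.le (h0 x)
    have h4 : t * η x ≤ η x := mul_le_of_le_one_left (h0 x) ht1
    exact ⟨by linarith [hvA.1 x], by linarith⟩
  have hdown : ∀ E : Set K, MeasurableSet E → (∀ x ∈ E, 0 < β x) → (∀ x ∈ E, w x < v x) →
      contactMeasure ρ u E ≤ contactMeasure ρ v E := by
    intro E hE hEβ hEw
    refine measure_le_of_integral_le _ _ (β ⊓ (v - w)) (fun η h0 h1 => ?_) hE
      (fun x hx => lt_min (hEβ x hx) (sub_pos.2 (hEw x hx)))
      fun x => le_min (hβ x) (sub_nonneg.2 (hvA.1 x))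
    have h5 := hvar (-η) (fun t ht ht1 x => ?_) ?_
    · simp only [BoundedContinuousFunction.coe_neg, Pi.neg_apply, integral_neg] at h5
      linarith
    · have h2 : η x ≤ v x - w x := (h1 x).trans (min_le_right _ _)
      have h3 := mul_nonneg ht.le (h0 x)
      have h4 : t * η x ≤ η x := mul_le_of_le_one_left (h0 x) ht1
      simp only [BoundedContinuousFunction.coe_neg, Pi.neg_apply]
      exact ⟨by linarith, by linarith [hvA.2.1 x]⟩
    · simpa using h0 y
  have hmu : MeasurableSet {x : K | v x < u x} :=
    measurableSet_lt v.continuous.measurable u.continuous.measurable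
  have hmw : MeasurableSet {x : K | w x < v x} :=
    measurableSet_lt w.continuous.measurable v.continuous.measurable
  refine le_antisymm ?_ ?_
  · rw [← measure_inter_add_sdiff E hmu, ← measure_inter_add_sdiff (μ := contactMeasure ρ u) E hmu]
    refine add_le_add (hup _ (hE.inter hmu) (fun x hx => hEβ x hx.1) fun x hx => hx.2)
      (contactMeasure_le_of_eq ρ hvA.2.1 (hE.diff hmu) fun x hx =>
        le_antisymm (hvA.2.1 x) (not_lt.1 hx.2))
  · rw [← measure_inter_add_sdiff E hmw, ← measure_inter_add_sdiff (μ := contactMeasure ρ v) E hmw]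
    refine add_le_add (hdown _ (hE.inter hmw) (fun x hx => hEβ x hx.1) fun x hx => hx.2) ?_
    exact (hμ _ (hE.diff hmw) fun x hx => hEβ x hx.1).trans
      (contactMeasure_le_of_eq ρ hvA.1 (hE.diff hmw) fun x hx =>
        le_antisymm (hvA.1 x) (not_lt.1 hx.2))

end Prescribed

section Assembly

open Filter Topology
open scoped BoundedContinuousFunction

variable {n : ℕ}

lemma MAm_ball_eq_contactMeasure {x₀ : En n} {r : ℝ} (hr : 0 < r)
    [CompactSpace (Metric.closedBall x₀ r)] [Nonempty (Metric.closedBall x₀ r)] {ρ : ℝ}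
    (hρ : 0 ≤ ρ) {z : En n → ℝ} {z' : Metric.closedBall x₀ r →ᵇ ℝ} (hz : ∀ x, z' x = z x)
    (hz' : LipschitzWith ρ.toNNReal z') {s : Set (En n)} (hs : s ⊆ Metric.ball x₀ r)
    (hsm : MeasurableSet s) :
    MAm (Metric.ball x₀ r) z s = contactMeasure ρ z' (Subtype.val ⁻¹' s) := by
  have hsm' : MeasurableSet (Subtype.val ⁻¹' s : Set (Metric.closedBall x₀ r)) :=
    measurable_subtype_coe hsm
  have hzc : ContinuousOn z (Metric.closedBall x₀ r) := by
    rw [continuousOn_iff_continuous_domRestrict]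
    exact z'.continuous.congr hz
  rw [contactMeasure, Measure.map_apply (measurable_contact z') hsm',
    Measure.restrict_apply (measurable_contact z' hsm'), MAm]
  refine measure_congr (eventuallyEq_set.2 ?_)
  filter_upwards [ae_eq_conj_iff z'] with p hp
  simp only [mem_iUnion, exists_prop, mem_inter_iff, mem_preimage]
  constructor
  · rintro ⟨x, hxs, hpx⟩
    have hxK : x ∈ Metric.closedBall x₀ r := Metric.ball_subset_closedBall (hs hxs)
    have hc : contact z' p = ⟨x, hxK⟩ := by
      refine (hp _).1 (le_antisymm (le_conj z' p _) (ciSup_le fun y => ?_))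
      rw [hz, hz]
      have hy : (y : En n) ∈ closure (Metric.ball x₀ r) := by
        rw [closure_ball x₀ hr.ne']; exact y.2
      have h1 := ContinuousWithinAt.closure_le (f := fun y => z x + ⟪p, y - x⟫) (g := z) hy
        (by fun_prop) ((hzc _ y.2).mono Metric.ball_subset_closedBall) hpx
      simp only [inner_sub_right] at h1
      linarith
    refine ⟨by rw [hc]; exact hxs, mem_closedBall_zero_iff.2 ?_⟩
    have hcont : Continuous fun ε : ℝ => x + ε • p := by fun_prop
    have hev : ∀ᶠ ε in 𝓝[>] (0 : ℝ), x + ε • p ∈ Metric.ball x₀ r :=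
      nhdsWithin_le_nhds ((Metric.isOpen_ball.preimage hcont).mem_nhds (by simpa using hs hxs))
    obtain ⟨ε, hε, hε0⟩ := (hev.and self_mem_nhdsWithin).exists
    have hε0 : 0 < ε := hε0
    have h1 := hpx _ hε
    have h2 := hz'.dist_le_mul ⟨x + ε • p, Metric.ball_subset_closedBall hε⟩ ⟨x, hxK⟩
    rw [hz, hz, Real.coe_toNNReal _ hρ, Subtype.dist_eq, Real.dist_eq, dist_eq_norm] at h2
    simp only [add_sub_cancel_left, norm_smul, Real.norm_of_nonneg hε0.le] at h2
    rw [add_sub_cancel_left, inner_smul_right, real_inner_self_eq_norm_sq] at h1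
    have h3 := le_of_abs_le h2
    have h4 : ε * ‖p‖ ^ 2 ≤ ρ * (ε * ‖p‖) := by linarith
    rcases (norm_nonneg p).eq_or_lt with h0 | h0
    · rw [← h0]; exact hρ
    · by_contra! h5
      have := mul_lt_mul_of_pos_right h5 (mul_pos hε0 h0)
      nlinarith
  · rintro ⟨hps, -⟩
    refine ⟨_, hps, fun y hy => ?_⟩
    have h1 := (hp _).2 rfl
    have h2 := le_conj z' p ⟨y, Metric.ball_subset_closedBall hy⟩
    rw [← h1, hz, hz] at h2
    rw [inner_sub_right]
    linarith

lemma exists_norm_le_of_mem_subgrad {Ω K : Set (En n)} (hΩ : IsOpen Ω) {u : En n → ℝ}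
    (hu : ConvexOn ℝ Ω u) (hK : IsCompact K) (hKΩ : K ⊆ Ω) :
    ∃ ρ, ∀ x ∈ K, ∀ p ∈ subgrad Ω u x, ‖p‖ ≤ ρ := by
  obtain ⟨ε, hε, hεΩ⟩ := hK.exists_cthickening_subset_open hΩ hKΩ
  obtain ⟨M, hM⟩ := (hK.cthickening (r := ε)).exists_bound_of_continuousOn
    ((hu.continuousOn hΩ).mono hεΩ)
  refine ⟨2 * M / ε, fun x hx p hp => ?_⟩
  rcases eq_or_ne p 0 with rfl | hp0
  · rw [norm_zero]
    have := (norm_nonneg _).trans (hM x (Metric.self_subset_cthickening _ hx))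
    positivity
  have hpn : 0 < ‖p‖ := norm_pos_iff.2 hp0
  have hy : x + (ε / ‖p‖) • p ∈ Metric.cthickening ε K := by
    refine Metric.mem_cthickening_of_dist_le _ x ε K hx ?_
    rw [dist_eq_norm, add_sub_cancel_left, norm_smul, Real.norm_of_nonneg (by positivity)]
    field_simp
    rfl
  have h1 := hp _ (hεΩ hy)
  rw [add_sub_cancel_left, inner_smul_right, real_inner_self_eq_norm_sq] at h1
  have h2 := abs_le.1 (hM _ hy)
  have h3 := abs_le.1 (hM x (Metric.self_subset_cthickening _ hx))
  have h4 : ε / ‖p‖ * ‖p‖ ^ 2 = ‖p‖ * ε := by field_simp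
  rw [le_div_iff₀ hε]
  linarith

lemma isSupported_restrict {Ω K : Set (En n)} (hΩ : IsOpen Ω) {u : En n → ℝ}
    (hu : ConvexOn ℝ Ω u) (hKΩ : K ⊆ Ω) {ρ : ℝ} (hρ : ∀ x ∈ K, ∀ p ∈ subgrad Ω u x, ‖p‖ ≤ ρ) :
    IsSupported ρ fun x : K => u x := by
  intro x
  obtain ⟨p, hp⟩ := subgrad_nonempty hΩ hu (hKΩ x.2)
  exact ⟨p, hρ x x.2 p hp, fun x' => hp x' (hKΩ x'.2)⟩

lemma exists_MAm_eq_of_barrier {Ω W : Set (En n)} (hΩ : IsOpen Ω) (hW : IsOpen W)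
    {u w : En n → ℝ} (hu : ConvexOn ℝ Ω u) (hw : ConvexOn ℝ W w) {x₀ : En n} {R : ℝ} (hR : 0 < R)
    (hRΩ : Metric.closedBall x₀ R ⊆ Ω) (hRW : Metric.closedBall x₀ R ⊆ W)
    (hwu : ∀ x ∈ Metric.closedBall x₀ R, w x ≤ u x) (hwx₀ : w x₀ = u x₀) {a b : ℝ≥0∞} (hab : a < b)
    (hMu : ∀ s ⊆ Ω, MeasurableSet s → MAm Ω u s ≤ a * volume s)
    (hMw : ∀ s ⊆ W, MeasurableSet s → b * volume s ≤ MAm W w s) :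
    ∃ r > 0, Metric.ball x₀ r ⊆ Ω ∧
      ∃ v : En n → ℝ, ConvexOn ℝ (Metric.ball x₀ r) v ∧
        (∀ x ∈ Metric.ball x₀ r, v x ≤ u x) ∧ v x₀ = u x₀ ∧
        ¬ (∀ x ∈ Metric.ball x₀ r, v x = u x) ∧
        (∀ s : Set (En n), s ⊆ Metric.ball x₀ r → MeasurableSet s →
          MAm (Metric.ball x₀ r) v s = MAm Ω u s) := by
  obtain ⟨y, hyR, hy⟩ : ∃ y ∈ Metric.ball x₀ R, w y < u y := by
    by_contra! h
    set B := Metric.ball x₀ R with hB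
    have hBΩ : B ⊆ Ω := Metric.ball_subset_closedBall.trans hRΩ
    have hBW : B ⊆ W := Metric.ball_subset_closedBall.trans hRW
    have heq : ∀ x ∈ B, w x = u x := fun x hx =>
      le_antisymm (hwu x (Metric.ball_subset_closedBall hx)) (h x hx)
    have h1 : MAm B w B = MAm B u B := by
      unfold MAm
      congr 1
      refine iUnion₂_congr fun x hx => ?_
      ext p
      refine forall₂_congr fun y hy => ?_
      rw [heq x hx, heq y hy]
    rw [MAm_eq_of_isOpen Metric.isOpen_ball hBW hw Subset.rfl,
      MAm_eq_of_isOpen Metric.isOpen_ball hBΩ hu Subset.rfl] at h1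
    have h2 := (hMw B hBW measurableSet_ball).trans
      (h1.le.trans (hMu B hBΩ measurableSet_ball))
    rw [ENNReal.mul_le_mul_iff_left (Metric.measure_ball_pos volume x₀ hR).ne'
      measure_ball_lt_top.ne] at h2
    exact absurd h2 (not_le.2 hab)
  set r := dist y x₀ with hr
  have hr0 : 0 < r := dist_pos.2 (by rintro rfl; exact hy.ne hwx₀)
  have hrR : r < R := hyR
  set K := Metric.closedBall x₀ r with hK
  set B := Metric.ball x₀ r with hB
  have hKk : IsCompact K := isCompact_closedBall _ _
  have hKR : K ⊆ Metric.closedBall x₀ R := Metric.closedBall_subset_closedBall hrR.le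
  have hBK : B ⊆ K := Metric.ball_subset_closedBall
  have hKΩ := hKR.trans hRΩ
  have hKW := hKR.trans hRW
  have : CompactSpace K := isCompact_iff_compactSpace.1 hKk
  have : Nonempty K := ⟨⟨x₀, Metric.mem_closedBall_self hr0.le⟩⟩
  obtain ⟨ρ₁, hρ₁⟩ := exists_norm_le_of_mem_subgrad hΩ hu hKk hKΩ
  obtain ⟨ρ₂, hρ₂⟩ := exists_norm_le_of_mem_subgrad hW hw hKk hKW
  set ρ := max 0 (max ρ₁ ρ₂) with hρ
  have hρ0 : 0 ≤ ρ := le_max_left _ _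
  have hsu := isSupported_restrict hΩ hu hKΩ (ρ := ρ) fun x hx p hp =>
    (hρ₁ x hx p hp).trans ((le_max_left _ _).trans (le_max_right _ _))
  have hsw := isSupported_restrict hW hw hKW (ρ := ρ) fun x hx p hp =>
    (hρ₂ x hx p hp).trans ((le_max_right _ _).trans (le_max_right _ _))
  set u' : K →ᵇ ℝ := .mkOfCompact ⟨_, hsu.lipschitzWith.continuous⟩ with hu'
  set w' : K →ᵇ ℝ := .mkOfCompact ⟨_, hsw.lipschitzWith.continuous⟩ with hw'
  set β : K →ᵇ ℝ := .mkOfCompact ⟨fun x => r - dist (x : En n) x₀, by fun_prop⟩ with hβ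
  have hyK : y ∈ K := Metric.mem_closedBall.2 le_rfl
  have hEB : ∀ E : Set K, (∀ x ∈ E, 0 < β x) → Subtype.val '' E ⊆ B := by
    rintro E hE _ ⟨x, hx, rfl⟩
    exact sub_pos.1 (hE x hx)
  have hEm : ∀ E : Set K, MeasurableSet E → MeasurableSet (Subtype.val '' E) := fun E hE =>
    (MeasurableEmbedding.subtype_coe hKk.measurableSet).measurableSet_image.2 hE
  have hub : ∀ s ⊆ B, MeasurableSet s → MAm Ω u s = contactMeasure ρ u' (Subtype.val ⁻¹' s) := by
    intro s hs hsm
    rw [← MAm_eq_of_isOpen Metric.isOpen_ball (hBK.trans hKΩ) hu hs]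
    exact MAm_ball_eq_contactMeasure hr0 hρ0 (fun _ => rfl) hsu.lipschitzWith hs hsm
  have hwb : ∀ s ⊆ B, MeasurableSet s → MAm W w s = contactMeasure ρ w' (Subtype.val ⁻¹' s) := by
    intro s hs hsm
    rw [← MAm_eq_of_isOpen Metric.isOpen_ball (hBK.trans hKW) hw hs]
    exact MAm_ball_eq_contactMeasure hr0 hρ0 (fun _ => rfl) hsw.lipschitzWith hs hsm
  obtain ⟨v, hv, hvμ⟩ := exists_contactMeasure_eq hρ0 (u := u') (w := w')
    (fun x => hwu x (hKR x.2)) hsw ⟨y, hyK⟩ β (fun x => sub_nonneg.2 x.2) (sub_self _)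
    fun E hE hEβ => by
      have h1 := hub _ (hEB E hEβ) (hEm E hE)
      have h2 := hwb _ (hEB E hEβ) (hEm E hE)
      rw [preimage_image_eq _ Subtype.val_injective] at h1 h2
      rw [← h1, ← h2]
      refine (hMu _ ((hEB E hEβ).trans (hBK.trans hKΩ)) (hEm E hE)).trans (le_trans ?_
        (hMw _ ((hEB E hEβ).trans (hBK.trans hKW)) (hEm E hE)))
      gcongr
  classical
  set z : En n → ℝ := fun x => if h : x ∈ K then v ⟨x, h⟩ else 0 with hz
  have hzv : ∀ x : K, v x = z x := fun x => by simp [hz, x.2]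
  have hzK : ∀ x (hx : x ∈ K), z x = v ⟨x, hx⟩ := fun x hx => (hzv ⟨x, hx⟩).symm
  obtain ⟨hwv, hvu, hvy, hvl, hvc⟩ := hv
  have hx₀K : x₀ ∈ K := Metric.mem_closedBall_self hr0.le
  refine ⟨r, hr0, hBK.trans hKΩ, z, ⟨convex_ball _ _, fun x hx x' hx' s t hs ht hst => ?_⟩,
    fun x hx => ?_, ?_, fun h => ?_, fun s hs hsm => ?_⟩
  · rw [hzK x (hBK hx), hzK x' (hBK hx'),
      hzK _ ((convex_closedBall x₀ r) (hBK hx) (hBK hx') hs ht hst)]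
    exact hvc _ _ _ s t hs ht hst rfl
  · rw [hzK x (hBK hx)]
    exact hvu ⟨x, hBK hx⟩
  · rw [hzK x₀ hx₀K]
    exact le_antisymm (hvu ⟨x₀, hx₀K⟩) (hwx₀.symm.le.trans (hwv ⟨x₀, hx₀K⟩))
  · have hzc : ContinuousOn z K := by
      rw [continuousOn_iff_continuous_domRestrict]
      exact v.continuous.congr hzv
    have hyc : y ∈ closure B := by rw [hB, closure_ball x₀ hr0.ne']; exact hyK
    have h1 := ContinuousWithinAt.closure_le hyc
      ((((hu.continuousOn hΩ).mono hKΩ) y hyK).mono hBK) ((hzc y hyK).mono hBK)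
      fun x hx => (h x hx).ge
    rw [hzK y hyK] at h1
    exact absurd (h1.trans hvy) (not_le.2 hy)
  · rw [hub s hs hsm, ← hvμ _ (measurable_subtype_coe hsm) fun x hx => sub_pos.2 (hs hx)]
    exact MAm_ball_eq_contactMeasure hr0 hρ0 hzv hvl hs hsm

end Assembly

/-- Theorem 1.1 (Theorem `thm:smp nece`): failure of the strong maximum principle at
non-strictly convex points. -/
theorem statement_0 {n : ℕ} (Ω : Set (En n)) (hΩ : IsOpen Ω)
    (u : En n → ℝ) (hu : ConvexOn ℝ Ω u)
    (lam Lam : ℝ) (hlam : 0 < lam) (hLam : lam ≤ Lam)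
    (hMA : ∀ s : Set (En n), s ⊆ Ω → MeasurableSet s →
      ENNReal.ofReal lam * volume s ≤ MAm Ω u s ∧ MAm Ω u s ≤ ENNReal.ofReal Lam * volume s)
    (a b : En n) (hab : a ≠ b) (hseg : segment ℝ a b ⊆ SigmaSet Ω u)
    (x₀ : En n) (hx₀ : x₀ ∈ openSegment ℝ a b) :
    ∃ r > 0, Metric.ball x₀ r ⊆ Ω ∧
      ∃ v : En n → ℝ, ConvexOn ℝ (Metric.ball x₀ r) v ∧
        (∀ x ∈ Metric.ball x₀ r, v x ≤ u x) ∧ v x₀ = u x₀ ∧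
        ¬ (∀ x ∈ Metric.ball x₀ r, v x = u x) ∧
        (∀ s : Set (En n), s ⊆ Metric.ball x₀ r → MeasurableSet s →
          MAm (Metric.ball x₀ r) v s = MAm Ω u s) := by
  obtain ⟨hx₀Ω, hx₀s⟩ := hseg (openSegment_subset_segment ℝ a b hx₀)
  obtain ⟨x, hxΩ, hxne, hx⟩ : ∃ x ∈ Ω, x ≠ x₀ ∧ (u x + u x₀) / 2 ≤ u ((1/2 : ℝ) • (x + x₀)) := by
    by_contra! h
    exact hx₀s h
  set m := (1/2 : ℝ) • (x + x₀) with hm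
  have hmΩ : m ∈ Ω := by
    rw [hm, smul_add]
    exact hu.1 hxΩ hx₀Ω (by norm_num) (by norm_num) (by norm_num)
  obtain ⟨p, hp⟩ := subgrad_nonempty hΩ hu hmΩ
  set c := u m - ⟪p, m⟫ with hc
  set U : En n → ℝ := fun y => u y - (⟪p, y⟫ + c) with hU
  have hU0 : ∀ y ∈ Ω, 0 ≤ U y := by
    intro y hy
    have h := hp y hy
    rw [inner_sub_right] at h
    simp only [hU, hc]
    linarith
  have hpm : ⟪p, m⟫ = (⟪p, x⟫ + ⟪p, x₀⟫) / 2 := by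
    rw [hm, inner_smul_right, inner_add_right]
    ring
  have hsum : U x + U x₀ ≤ 0 := by
    simp only [hU, hc, hpm]
    linarith
  have hUx := hU0 x hxΩ
  have hUx₀ := hU0 x₀ hx₀Ω
  have hUc : ConvexOn ℝ Ω U := convexOn_sub_inner hu p c
  have hMU : ∀ s : Set (En n), s ⊆ Ω → MeasurableSet s →
      ENNReal.ofReal lam * volume s ≤ MAm Ω U s ∧ MAm Ω U s ≤ ENNReal.ofReal Lam * volume s := by
    intro s hs hsm
    rw [hU, MAm_sub_inner]
    exact hMA s hs hsm
  obtain ⟨a', b', hab', hx₀', hseg'⟩ := exists_mem_openSegment_of_eq_zero hΩ hUc hlam hMU hU0 hx₀Ω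
    hxΩ hxne (by linarith) (by linarith)
  obtain ⟨W, w, R, hW, hw, hR, hRW, hRΩ, hwU, hwx₀, hMw⟩ := exists_barrier hΩ hUc hlam
    (fun s hs hsm => (hMU s hs hsm).1) hab' hx₀' hseg' (Lam + 1)
  obtain ⟨r, hr, hrΩ, v, hv, hvU, hvx₀, hne, hMv⟩ := exists_MAm_eq_of_barrier hΩ hW hUc hw hR hRΩ
    hRW hwU hwx₀ ((ENNReal.ofReal_lt_ofReal_iff (by linarith)).2 (lt_add_one Lam))
    (fun s hs hsm => (hMU s hs hsm).2) hMw
  refine ⟨r, hr, hrΩ, fun y => v y + (⟪p, y⟫ + c), ?_, ?_, ?_, ?_, ?_⟩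
  · refine (convexOn_sub_inner hv (-p) (-c)).congr fun y _ => ?_
    simp only [inner_neg_left]
    ring
  · intro y hy
    have h := hvU y hy
    simp only [hU] at h
    linarith
  · simp only [hvx₀, hU]
    ring
  · refine fun h => hne fun y hy => ?_
    simp only [hU, ← h y hy]
    ring
  · intro s hs hsm
    rw [MAm_add_inner, hMv s hs hsm, hU, MAm_sub_inner]
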